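/- arXiv:2404.17414 — 6 statements merged into one kernel-verified Lean document; each statement's English description precedes it below -/
import Mathlib

section
/- For every real number ξ > 1, the Hausdorff dimension of the level set E(ξ) = {x ∈ (0,1] : lim_{n→∞} (1/n) ∑_{j=1}^{n} d_j(x) = ξ} equals (log(ξ−1)/ξ + log ξ − log(ξ−1)) / log 2. -/
open MeasureTheory Filter Real Set

/-- The power-2-decaying Gauss-like expansion map: `T x = 2^n x - 1` for
`x ∈ (2^{-n}, 2^{-(n-1)}]`, where the branch index is `n = ⌊-log₂ x⌋ + 1`. -/
noncomputable def p2gleT (x : ℝ) : ℝ := 2 ^ (⌊-Real.logb 2 x⌋ + 1) * x - 1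

/-- The `(j+1)`-th P2GLE digit: `d_{j+1}(x) = d₁(T^j x)` with `d₁(x) = ⌈-log₂ x⌉`. -/
noncomputable def p2gleD (j : ℕ) (x : ℝ) : ℤ := ⌈-Real.logb 2 (p2gleT^[j] x)⌉

/-- The level set `E(ξ)` of points whose Khintchine exponent equals `ξ`. -/
noncomputable def khinchinLevelSet (ξ : ℝ) : Set ℝ :=
  {x ∈ Ioc (0:ℝ) 1 |
    Tendsto (fun n : ℕ => (∑ j ∈ Finset.range n, (p2gleD j x : ℝ)) / n) atTop (nhds ξ)}

/-- The doubling map `x ↦ 2 * x mod 1`. -/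
noncomputable def doublingMap (x : ℝ) : ℝ := Int.fract (2 * x)

/-- The positions `i < m` at which the binary expansion of `x ∈ [0, 1)` has the digit `1`. -/
noncomputable def binaryOnes (m : ℕ) (x : ℝ) : Finset ℕ :=
  {i ∈ Finset.range m | 1 / 2 ≤ doublingMap^[i] x}

lemma binaryOnes_card_eq_sum (m : ℕ) (x : ℝ) :
    (binaryOnes m x).card =
      ∑ i ∈ Finset.range m, if 1 / 2 ≤ doublingMap^[i] x then 1 else 0 := by
  rw [binaryOnes, Finset.card_filter]

lemma binaryOnes_card_le (m : ℕ) (x : ℝ) : (binaryOnes m x).card ≤ m := by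
  exact (Finset.card_filter_le _ _).trans (Finset.card_range m).le

lemma binaryOnes_card_add (m k : ℕ) (x : ℝ) :
    (binaryOnes (m + k) x).card =
      (binaryOnes m x).card + (binaryOnes k (doublingMap^[m] x)).card := by
  rw [binaryOnes_card_eq_sum, binaryOnes_card_eq_sum, binaryOnes_card_eq_sum,
    Finset.sum_range_add]
  simp only [← Function.iterate_add_apply, add_comm m]

lemma binaryOnes_card_mono (x : ℝ) : Monotone fun m => (binaryOnes m x).card := by
  intro m n h
  obtain ⟨k, rfl⟩ := Nat.exists_eq_add_of_le h
  simp only [binaryOnes_card_add]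
  omega

lemma doublingMap_of_lt_half {x : ℝ} (h0 : 0 ≤ x) (h : x < 1 / 2) : doublingMap x = 2 * x := by
  rw [doublingMap, Int.fract_eq_self]
  constructor <;> linarith

lemma doublingMap_of_half_le {x : ℝ} (h : 1 / 2 ≤ x) (h1 : x < 1) :
    doublingMap x = 2 * x - 1 := by
  rw [doublingMap, Int.fract_eq_iff]
  refine ⟨by linarith, by linarith, 1, by norm_num⟩

lemma doublingMap_iterate_mem {x : ℝ} (hx : x ∈ Ico (0 : ℝ) 1) (m : ℕ) :
    doublingMap^[m] x ∈ Ico (0 : ℝ) 1 := by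
  cases m with
  | zero => exact hx
  | succ m =>
    rw [Function.iterate_succ_apply']
    exact ⟨Int.fract_nonneg _, Int.fract_lt_one _⟩

/-- Binary expansion of `x` to `m` digits, with the remainder expressed by the doubling map. -/
lemma eq_sum_binaryOnes_add {x : ℝ} (hx : x ∈ Ico (0 : ℝ) 1) (m : ℕ) :
    x = ∑ i ∈ binaryOnes m x, (1 / 2 : ℝ) ^ (i + 1) + (1 / 2) ^ m * doublingMap^[m] x := by
  induction m with
  | zero => simp [binaryOnes]
  | succ m ih =>
    have hy := doublingMap_iterate_mem hx m
    rw [Function.iterate_succ_apply']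
    have hsum : ∑ i ∈ binaryOnes (m + 1) x, (1 / 2 : ℝ) ^ (i + 1) =
        ∑ i ∈ binaryOnes m x, (1 / 2 : ℝ) ^ (i + 1) +
          if 1 / 2 ≤ doublingMap^[m] x then (1 / 2 : ℝ) ^ (m + 1) else 0 := by
      simp only [binaryOnes, Finset.sum_filter, Finset.sum_range_succ]
    rw [hsum]
    split_ifs with h
    · rw [doublingMap_of_half_le h hy.2, pow_succ]
      linarith
    · rw [doublingMap_of_lt_half hy.1 (not_le.mp h), pow_succ]
      linarith

/-- The points of `(0, 1)` whose binary expansion does not terminate. -/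
def nonDyadic : Set ℝ := {x ∈ Ico (0 : ℝ) 1 | ∀ m, doublingMap^[m] x ≠ 0}

lemma nonDyadic_iterate {x : ℝ} (hx : x ∈ nonDyadic) (m : ℕ) :
    doublingMap^[m] x ∈ nonDyadic := by
  refine ⟨doublingMap_iterate_mem hx.1 m, fun k => ?_⟩
  rw [← Function.iterate_add_apply]
  exact hx.2 _

lemma countable_Ico_diff_nonDyadic : (Ico (0 : ℝ) 1 \ nonDyadic).Countable := by
  refine (countable_range fun q : Finset ℕ => ∑ i ∈ q, (1 / 2 : ℝ) ^ (i + 1)).mono ?_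
  rintro x ⟨hx, hn⟩
  have : ∃ m, doublingMap^[m] x = 0 := by
    by_contra! h
    exact hn ⟨hx, h⟩
  obtain ⟨m, hm⟩ := this
  refine ⟨binaryOnes m x, ?_⟩
  have h := eq_sum_binaryOnes_add hx m
  rw [hm, mul_zero, add_zero] at h
  exact h.symm

/-- If the first `1` in the binary expansion of `x` is at position `k`, deleting everything up to
and including it amounts to `k + 1` iterations of the doubling map. -/
lemma doublingMap_first_return (k : ℕ) {x : ℝ} (h1 : 1 < 2 ^ (k + 1) * x) (h2 : 2 ^ k * x < 1) :
    doublingMap^[k + 1] x = 2 ^ (k + 1) * x - 1 ∧ (binaryOnes (k + 1) x).card = 1 := by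
  induction k generalizing x with
  | zero =>
    have h : 1 / 2 ≤ x := by norm_num at h1; linarith
    norm_num at h2
    rw [binaryOnes_card_eq_sum]
    simp only [zero_add, Finset.sum_range_one, Function.iterate_one, Function.iterate_zero, id,
      doublingMap_of_half_le h h2, pow_one]
    exact ⟨trivial, if_pos h⟩
  | succ k ih =>
    have h0 : 0 < x := by
      by_contra! h
      have := mul_nonpos_of_nonneg_of_nonpos (by positivity : (0 : ℝ) ≤ 2 ^ (k + 1 + 1)) h
      linarith
    have hk : (1 : ℝ) ≤ 2 ^ k := one_le_pow₀ (by norm_num)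
    have hx : x < 1 / 2 := by
      rw [pow_succ] at h2
      nlinarith
    have hD := doublingMap_of_lt_half h0.le hx
    obtain ⟨e1, e2⟩ := ih (x := 2 * x) (by rw [pow_succ] at h1; linarith)
      (by rw [pow_succ] at h2; linarith)
    constructor
    · rw [Function.iterate_succ_apply, hD, e1]
      ring
    · rw [add_comm (k + 1) 1, binaryOnes_card_add, Function.iterate_one, hD, e2,
        binaryOnes_card_eq_sum]
      simpa using hx

lemma p2gle_step {x : ℝ} (hx : x ∈ nonDyadic) :
    ∃ k : ℕ, p2gleD 0 x = k + 1 ∧ p2gleT x = doublingMap^[k + 1] x ∧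
      (binaryOnes (k + 1) x).card = 1 := by
  have h0 : 0 < x := lt_of_le_of_ne hx.1.1 (hx.2 0).symm
  have hlog : 0 ≤ -Real.logb 2 x := by
    have := Real.logb_nonpos (b := 2) (by norm_num) h0.le hx.1.2.le
    linarith
  obtain ⟨k, hk⟩ := Int.eq_ofNat_of_zero_le (Int.floor_nonneg.mpr hlog)
  have hk' := Int.floor_eq_iff.mp hk
  push_cast at hk'
  have hle : 2 ^ k * x ≤ 1 := by
    have h : Real.logb 2 x ≤ -(k : ℝ) := by linarith [hk'.1]
    rw [Real.logb_le_iff_le_rpow (by norm_num) h0, Real.rpow_neg (by norm_num),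
      Real.rpow_natCast] at h
    calc 2 ^ k * x ≤ 2 ^ k * (2 ^ k)⁻¹ := by gcongr
      _ = 1 := by field_simp
  have h1 : 1 < 2 ^ (k + 1) * x := by
    have h : -((k + 1 : ℕ) : ℝ) < Real.logb 2 x := by push_cast; linarith [hk'.2]
    rw [Real.lt_logb_iff_rpow_lt (by norm_num) h0, Real.rpow_neg (by norm_num),
      Real.rpow_natCast] at h
    calc (1 : ℝ) = 2 ^ (k + 1) * (2 ^ (k + 1))⁻¹ := by field_simp
      _ < _ := by gcongr
  have hne : 2 ^ k * x ≠ 1 := by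
    intro h
    have hd : ∀ k : ℕ, ∀ x : ℝ, x < 1 → 2 ^ k * x = 1 → doublingMap^[k] x = 0 := by
      intro k
      induction k with
      | zero => intro x hx h; norm_num at h; linarith
      | succ k ih =>
        intro x hx h
        rw [Function.iterate_succ_apply]
        have hx' : 0 < x := by
          by_contra! h'
          have := mul_nonpos_of_nonneg_of_nonpos (by positivity : (0 : ℝ) ≤ 2 ^ (k + 1)) h'
          linarith
        have hk : (1 : ℝ) ≤ 2 ^ k := one_le_pow₀ (by norm_num)
        have hxh : x ≤ 1 / 2 := by
          rw [pow_succ] at h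
          nlinarith
        rcases hxh.lt_or_eq with hlt | rfl
        · rw [doublingMap_of_lt_half hx'.le hlt]
          refine ih _ (by linarith) (by rw [pow_succ] at h; linarith)
        · have : doublingMap (1 / 2) = 0 := by norm_num [doublingMap]
          rw [this]
          have : Function.IsFixedPt doublingMap 0 := by
            norm_num [doublingMap, Function.IsFixedPt]
          exact this.iterate k
    exact hx.2 k (hd k x hx.1.2 h)
  have h2 : 2 ^ k * x < 1 := lt_of_le_of_ne hle hne
  obtain ⟨e1, e2⟩ := doublingMap_first_return k h1 h2
  refine ⟨k, ?_, ?_, e2⟩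
  · rw [p2gleD, Function.iterate_zero, id, Int.ceil_eq_iff]
    push_cast
    refine ⟨?_, hk'.2.le⟩
    have : Real.logb 2 x < -(k : ℝ) := by
      rw [Real.logb_lt_iff_lt_rpow (by norm_num) h0, Real.rpow_neg (by norm_num),
        Real.rpow_natCast]
      rw [lt_inv_comm₀ h0 (by positivity), inv_eq_one_div, lt_div_iff₀ h0]
      exact h2
    linarith
  · rw [e1, p2gleT, hk]
    congr 2

lemma p2gleT_iterate_eq {x : ℝ} (hx : x ∈ nonDyadic) :
    ∃ S : ℕ → ℕ, S 0 = 0 ∧ StrictMono S ∧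
      (∀ j, ∑ i ∈ Finset.range j, (p2gleD i x : ℝ) = S j) ∧
      ∀ j, (binaryOnes (S j) x).card = j := by
  have key : ∀ j : ℕ, ∃ n : ℕ, ∑ i ∈ Finset.range j, p2gleD i x = n ∧
      p2gleT^[j] x = doublingMap^[n] x ∧ (binaryOnes n x).card = j := by
    intro j
    induction j with
    | zero => exact ⟨0, by simp [binaryOnes]⟩
    | succ j ih =>
      obtain ⟨n, h1, h2, h3⟩ := ih
      obtain ⟨k, e1, e2, e3⟩ := p2gle_step (nonDyadic_iterate hx n)
      refine ⟨n + (k + 1), ?_, ?_, ?_⟩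
      · have : p2gleD j x = p2gleD 0 (p2gleT^[j] x) := by simp [p2gleD]
        rw [Finset.sum_range_succ, h1, this, h2, e1]
        push_cast
        ring
      · rw [Function.iterate_succ_apply', h2, e2, ← Function.iterate_add_apply, add_comm n]
      · rw [binaryOnes_card_add, h3, e3]
  choose S h1 h2 h3 using key
  refine ⟨S, ?_, ?_, fun j => ?_, h3⟩
  · have := h1 0
    simp at this
    exact_mod_cast this.symm
  · refine strictMono_nat_of_lt_succ fun j => ?_
    by_contra! h
    have := binaryOnes_card_mono x h
    simp only [h3] at this
    omega
  · have := h1 j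
    exact_mod_cast this

lemma tendsto_inverse_counting_iff {S N : ℕ → ℕ} (hS0 : S 0 = 0) (hS : StrictMono S)
    (hN : Monotone N) (hNS : ∀ j, N (S j) = j) {ξ : ℝ} (hξ : 0 < ξ) :
    Tendsto (fun j => (S j : ℝ) / j) atTop (nhds ξ) ↔
      Tendsto (fun m => (N m : ℝ) / m) atTop (nhds ξ⁻¹) := by
  constructor
  · intro h
    have hNtop : Tendsto N atTop atTop :=
      tendsto_atTop_atTop.mpr fun b => ⟨S b, fun a ha => (hNS b).symm.le.trans (hN ha)⟩
    have hlow : ∀ m, S (N m - 1) ≤ m := by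
      intro m
      by_contra! h
      rcases Nat.eq_zero_or_pos (N m) with h0 | h0
      · simp [h0, hS0] at h
      · have := hN h.le
        rw [hNS] at this
        omega
    have hupp : ∀ m, m ≤ S (N m + 1) := by
      intro m
      by_contra! h
      have := hN h.le
      rw [hNS] at this
      omega
    have hpred : Tendsto (fun n : ℕ => ((n - 1 : ℕ) : ℝ) / n) atTop (nhds 1) := by
      have h1 : Tendsto (fun n : ℕ => 1 - 1 / (n : ℝ)) atTop (nhds (1 - 0)) :=
        tendsto_const_nhds.sub tendsto_one_div_atTop_nhds_zero_nat
      rw [sub_zero] at h1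
      refine h1.congr' ?_
      filter_upwards [eventually_ge_atTop 1] with n hn
      have : (n : ℝ) ≠ 0 := by positivity
      rw [Nat.cast_sub hn]
      field_simp
      simp
    have hsucc : Tendsto (fun n : ℕ => ((n + 1 : ℕ) : ℝ) / n) atTop (nhds 1) := by
      have h1 : Tendsto (fun n : ℕ => 1 + 1 / (n : ℝ)) atTop (nhds (1 + 0)) :=
        tendsto_const_nhds.add tendsto_one_div_atTop_nhds_zero_nat
      rw [add_zero] at h1
      refine h1.congr' ?_
      filter_upwards [eventually_ge_atTop 1] with n hn
      have : (n : ℝ) ≠ 0 := by positivity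
      push_cast
      field_simp
    have hl : Tendsto (fun n : ℕ => (S (n - 1) : ℝ) / n) atTop (nhds ξ) := by
      have := (h.comp (tendsto_sub_atTop_nat 1)).mul hpred
      rw [mul_one] at this
      refine this.congr' ?_
      filter_upwards [eventually_ge_atTop 2] with n hn
      have : ((n - 1 : ℕ) : ℝ) ≠ 0 := by
        have : n - 1 ≠ 0 := by omega
        exact_mod_cast this
      simp only [Function.comp]
      field_simp
    have hu : Tendsto (fun n : ℕ => (S (n + 1) : ℝ) / n) atTop (nhds ξ) := by
      have := (h.comp (tendsto_add_atTop_nat 1)).mul hsucc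
      rw [mul_one] at this
      refine this.congr' ?_
      filter_upwards [eventually_ge_atTop 2] with n hn
      have : ((n + 1 : ℕ) : ℝ) ≠ 0 := by positivity
      simp only [Function.comp]
      field_simp
    have hm : Tendsto (fun m : ℕ => (m : ℝ) / N m) atTop (nhds ξ) := by
      refine tendsto_of_tendsto_of_tendsto_of_le_of_le (hl.comp hNtop) (hu.comp hNtop) ?_ ?_
      · intro m
        simp only [Function.comp]
        gcongr
        exact hlow m
      · intro m
        simp only [Function.comp]
        gcongr
        exact hupp m
    simpa using hm.inv₀ hξ.ne'
  · intro h
    have := (h.comp hS.tendsto_atTop).inv₀ (inv_pos.mpr hξ).ne'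
    simpa [Function.comp_def, hNS] using this

/-- Off the dyadic rationals, `ξ` is the Khintchine exponent iff `1 / ξ` is the frequency of the
binary digit `1`. -/
lemma khinchine_iff_frequency {x : ℝ} (hx : x ∈ nonDyadic) {ξ : ℝ} (hξ : 0 < ξ) :
    x ∈ khinchinLevelSet ξ ↔
      Tendsto (fun m : ℕ => ((binaryOnes m x).card : ℝ) / m) atTop (nhds ξ⁻¹) := by
  obtain ⟨S, h0, hS, hsum, hcard⟩ := p2gleT_iterate_eq hx
  rw [← tendsto_inverse_counting_iff h0 hS (binaryOnes_card_mono x) hcard hξ]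
  have hmem : x ∈ Ioc (0 : ℝ) 1 := ⟨lt_of_le_of_ne hx.1.1 (hx.2 0).symm, hx.1.2.le⟩
  simp only [khinchinLevelSet, mem_ofPred_eq, hmem, true_and, hsum]

lemma pow_mul_pow_sub_eq_exp {p : ℝ} (hp0 : 0 < p) (hp1 : p < 1) {m k : ℕ} (hm : 0 < m)
    (hk : k ≤ m) :
    p ^ k * (1 - p) ^ (m - k) =
      Real.exp (m * ((k : ℝ) / m * Real.log p + (1 - (k : ℝ) / m) * Real.log (1 - p))) := by
  have h1 : 0 < 1 - p := by linarith
  have hm' : (m : ℝ) ≠ 0 := by positivity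
  have e : (m : ℝ) * ((k : ℝ) / m * Real.log p + (1 - (k : ℝ) / m) * Real.log (1 - p)) =
      k * Real.log p + ((m - k : ℕ) : ℝ) * Real.log (1 - p) := by
    rw [Nat.cast_sub hk]
    field_simp
  rw [e, Real.exp_add, mul_comm (k : ℝ), mul_comm ((m - k : ℕ) : ℝ), Real.exp_mul, Real.exp_mul,
    Real.exp_log hp0, Real.exp_log h1, Real.rpow_natCast, Real.rpow_natCast]

lemma half_pow_rpow_eq_exp (m : ℕ) (s : ℝ) :
    ((1 / 2 : ℝ) ^ m) ^ s = Real.exp (m * -(s * Real.log 2)) := by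
  rw [Real.rpow_def_of_pos (by positivity), Real.log_pow, one_div, Real.log_inv]
  ring_nf

lemma tendsto_log_weight {p : ℝ} {k : ℕ → ℕ}
    (hlim : Tendsto (fun m : ℕ => (k m : ℝ) / m) atTop (nhds p)) :
    Tendsto (fun m : ℕ => (k m : ℝ) / m * Real.log p + (1 - (k m : ℝ) / m) * Real.log (1 - p))
      atTop (nhds (-Real.binEntropy p)) := by
  have e : -Real.binEntropy p = p * Real.log p + (1 - p) * Real.log (1 - p) := by
    rw [Real.binEntropy, Real.log_inv, Real.log_inv]
    ring
  rw [e]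
  exact (hlim.mul_const _).add ((tendsto_const_nhds.sub hlim).mul_const _)

lemma eventually_half_pow_le_weight {p s : ℝ} (hp0 : 0 < p) (hp1 : p < 1)
    (hs : Real.binEntropy p < s * Real.log 2) {k : ℕ → ℕ} (hk : ∀ m, k m ≤ m)
    (hlim : Tendsto (fun m : ℕ => (k m : ℝ) / m) atTop (nhds p)) :
    ∀ᶠ m in atTop, ((1 / 2 : ℝ) ^ m) ^ s ≤ p ^ k m * (1 - p) ^ (m - k m) := by
  filter_upwards [(tendsto_log_weight hlim).eventually_const_lt (neg_lt_neg hs),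
    eventually_gt_atTop 0] with m hm hm0
  rw [pow_mul_pow_sub_eq_exp hp0 hp1 hm0 (hk m), half_pow_rpow_eq_exp]
  gcongr

lemma eventually_weight_le_half_pow {p s : ℝ} (hp0 : 0 < p) (hp1 : p < 1)
    (hs : s * Real.log 2 < Real.binEntropy p) {k : ℕ → ℕ} (hk : ∀ m, k m ≤ m)
    (hlim : Tendsto (fun m : ℕ => (k m : ℝ) / m) atTop (nhds p)) :
    ∀ᶠ m in atTop, p ^ k m * (1 - p) ^ (m - k m) ≤ ((1 / 2 : ℝ) ^ m) ^ s := by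
  filter_upwards [(tendsto_log_weight hlim).eventually_lt_const (neg_lt_neg hs),
    eventually_gt_atTop 0] with m hm hm0
  rw [pow_mul_pow_sub_eq_exp hp0 hp1 hm0 (hk m), half_pow_rpow_eq_exp]
  gcongr

lemma hausdorffMeasure_le_one_of_le_weight {p : ℝ} (hp0 : 0 < p) (hp1 : p < 1) {s : ℝ} {A : Set ℝ}
    (hA : A ⊆ Ico 0 1) (M : ℕ)
    (h : ∀ x ∈ A, ∀ m ≥ M, ((1 / 2 : ℝ) ^ m) ^ s ≤
      p ^ (binaryOnes m x).card * (1 - p) ^ (m - (binaryOnes m x).card)) :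
    μH[s] A ≤ 1 := by
  have hq : 0 < 1 - p := by linarith
  let c : Finset ℕ → ℝ := fun T => ∑ i ∈ T, (1 / 2 : ℝ) ^ (i + 1)
  let good : ℕ → Finset (Finset ℕ) := fun m =>
    {T ∈ (Finset.range m).powerset | ((1 / 2 : ℝ) ^ m) ^ s ≤ p ^ T.card * (1 - p) ^ (m - T.card)}
  let t : ∀ m : ℕ, good m → Set ℝ := fun m T => Icc (c T) (c T + (1 / 2) ^ m)
  have hdiam : ∀ m (T : good m), Metric.ediam (t m T) = ENNReal.ofReal ((1 / 2) ^ m) := by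
    intro m T
    simp only [t, Real.ediam_Icc, add_sub_cancel_left]
  have hr : Tendsto (fun m : ℕ => ENNReal.ofReal ((1 / 2) ^ m)) atTop (nhds 0) := by
    rw [← ENNReal.ofReal_zero]
    exact ENNReal.tendsto_ofReal
      (tendsto_pow_atTop_nhds_zero_of_lt_one (by norm_num) (by norm_num))
  refine (Measure.hausdorffMeasure_le_liminf_sum s A _ hr t
    (Eventually.of_forall fun m T => (hdiam m T).le) ?_).trans ?_
  · filter_upwards [eventually_ge_atTop M] with m hm x hx
    have hmem : binaryOnes m x ∈ good m :=
      Finset.mem_filter.mpr ⟨Finset.mem_powerset.mpr (Finset.filter_subset _ _), h x hx m hm⟩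
    refine mem_iUnion.mpr ⟨⟨_, hmem⟩, ?_⟩
    have he := eq_sum_binaryOnes_add (hA hx) m
    have hd := doublingMap_iterate_mem (hA hx) m
    have hpos : (0 : ℝ) < (1 / 2) ^ m := by positivity
    simp only [t, c, mem_Icc]
    constructor <;> nlinarith [hd.1, hd.2]
  · refine liminf_le_of_le (by isBoundedDefault) fun b hb => ?_
    obtain ⟨m, hm⟩ := hb.exists
    refine hm.trans ?_
    simp only [hdiam]
    calc ∑ _T : good m, ENNReal.ofReal ((1 / 2) ^ m) ^ s
        ≤ ∑ T : good m, ENNReal.ofReal (p ^ T.1.card * (1 - p) ^ (m - T.1.card)) := by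
          refine Finset.sum_le_sum fun T _ => ?_
          rw [ENNReal.ofReal_rpow_of_pos (by positivity)]
          exact ENNReal.ofReal_le_ofReal (Finset.mem_filter.mp T.2).2
      _ = ∑ T ∈ good m, ENNReal.ofReal (p ^ T.card * (1 - p) ^ (m - T.card)) :=
          Finset.sum_coe_sort (good m)
            (fun T => ENNReal.ofReal (p ^ T.card * (1 - p) ^ (m - T.card)))
      _ ≤ ∑ T ∈ (Finset.range m).powerset,
            ENNReal.ofReal (p ^ T.card * (1 - p) ^ (m - T.card)) :=
          Finset.sum_le_sum_of_subset (Finset.filter_subset _ _)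
      _ = 1 := by
          rw [← ENNReal.ofReal_sum_of_nonneg fun _ _ => by positivity]
          have := Finset.sum_pow_mul_eq_add_pow p (1 - p) (Finset.range m)
          rw [Finset.card_range] at this
          rw [this]
          simp

lemma dimH_frequency_le {p : ℝ} (hp0 : 0 < p) (hp1 : p < 1) :
    dimH {x ∈ Ico (0 : ℝ) 1 |
      Tendsto (fun m : ℕ => ((binaryOnes m x).card : ℝ) / m) atTop (nhds p)} ≤
      ENNReal.ofReal (Real.binEntropy p / Real.log 2) := by
  refine le_of_forall_gt_imp_ge_of_dense fun r hr => ?_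
  obtain ⟨s, hs, hsr⟩ := ENNReal.lt_iff_exists_nnreal_btwn.mp hr
  refine le_trans ?_ hsr.le
  have hlog : 0 < Real.log 2 := Real.log_pos (by norm_num)
  have hs' : Real.binEntropy p < s * Real.log 2 := by
    rw [← ENNReal.ofReal_coe_nnreal] at hs
    exact (div_lt_iff₀ hlog).mp ((ENNReal.ofReal_lt_ofReal_iff'.mp hs).1)
  let A : ℕ → Set ℝ := fun M => {x ∈ Ico (0 : ℝ) 1 | ∀ m ≥ M, ((1 / 2 : ℝ) ^ m) ^ (s : ℝ) ≤
      p ^ (binaryOnes m x).card * (1 - p) ^ (m - (binaryOnes m x).card)}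
  calc _ ≤ dimH (⋃ M, A M) := by
        refine dimH_mono ?_
        rintro x ⟨hx, hlim⟩
        obtain ⟨M, hM⟩ := eventually_atTop.mp (eventually_half_pow_le_weight hp0 hp1 hs'
          (fun m => binaryOnes_card_le m x) hlim)
        exact mem_iUnion.mpr ⟨M, hx, hM⟩
    _ ≤ s := by
        rw [dimH_iUnion]
        refine iSup_le fun M => dimH_le_of_hausdorffMeasure_ne_top ?_
        exact ((hausdorffMeasure_le_one_of_le_weight hp0 hp1 (fun x hx => hx.1) M
          fun x hx => hx.2).trans_lt ENNReal.one_lt_top).ne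

/-- The point of `[0, 1]` with the given binary digits. -/
noncomputable def binaryPoint (ω : ℕ → Bool) : ℝ :=
  ∑' i, ((ω i).toNat : ℝ) * (1 / 2) ^ (i + 1)

/-- The integer whose binary digits are the first `m` terms of `ω`. -/
def binaryCode (ω : ℕ → Bool) : ℕ → ℕ
  | 0 => 0
  | m + 1 => 2 * binaryCode ω m + (ω m).toNat

/-- The number of terms of `ω` equal to `true` among the first `m`. -/
def trueCount (m : ℕ) (ω : ℕ → Bool) : ℕ := ∑ i ∈ Finset.range m, (ω i).toNat

lemma trueCount_le (m : ℕ) (ω : ℕ → Bool) : trueCount m ω ≤ m := by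
  calc trueCount m ω ≤ ∑ _i ∈ Finset.range m, 1 :=
        Finset.sum_le_sum fun i _ => Bool.toNat_le (ω i)
    _ = m := by simp

lemma binaryPoint_term_le (ω : ℕ → Bool) (i : ℕ) :
    ((ω i).toNat : ℝ) * (1 / 2) ^ (i + 1) ≤ (1 / 2) ^ (i + 1) := by
  have : ((ω i).toNat : ℝ) ≤ 1 := by exact_mod_cast Bool.toNat_le (ω i)
  exact mul_le_of_le_one_left (by positivity) this

lemma hasSum_half_pow_succ : HasSum (fun i : ℕ => (1 / 2 : ℝ) ^ (i + 1)) 1 := by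
  have := hasSum_geometric_two.mul_right (1 / 2 : ℝ)
  simpa [pow_succ] using this

lemma summable_binaryPoint (ω : ℕ → Bool) :
    Summable fun i => ((ω i).toNat : ℝ) * (1 / 2) ^ (i + 1) :=
  hasSum_half_pow_succ.summable.of_nonneg_of_le (fun _ => by positivity) (binaryPoint_term_le ω)

lemma binaryPoint_nonneg (ω : ℕ → Bool) : 0 ≤ binaryPoint ω := tsum_nonneg fun _ => by positivity

lemma binaryPoint_le_one (ω : ℕ → Bool) : binaryPoint ω ≤ 1 := by
  rw [← hasSum_half_pow_succ.tsum_eq]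
  exact (summable_binaryPoint ω).tsum_le_tsum (binaryPoint_term_le ω) hasSum_half_pow_succ.summable

lemma measurable_binaryPoint : Measurable binaryPoint := by
  refine Continuous.measurable ?_
  refine continuous_tsum (u := fun i : ℕ => (1 / 2 : ℝ) ^ (i + 1)) (fun i => ?_)
    hasSum_half_pow_succ.summable fun i ω => ?_
  · exact ((continuous_of_discreteTopology (f := fun b : Bool => (b.toNat : ℝ))).comp
      (continuous_apply i)).mul_const _
  · rw [Real.norm_of_nonneg (by positivity)]
    exact binaryPoint_term_le ω i

lemma two_mul_binaryPoint (ω : ℕ → Bool) :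
    2 * binaryPoint ω = (ω 0).toNat + binaryPoint fun i => ω (i + 1) := by
  rw [binaryPoint, (summable_binaryPoint ω).tsum_eq_zero_add, binaryPoint, mul_add, ← tsum_mul_left]
  congr 1
  · norm_num; ring
  · congr 1 with i
    ring

lemma two_pow_mul_binaryPoint (ω : ℕ → Bool) (m : ℕ) :
    2 ^ m * binaryPoint ω = binaryCode ω m + binaryPoint fun i => ω (i + m) := by
  induction m with
  | zero => simp [binaryCode]
  | succ m ih =>
    have h := two_mul_binaryPoint fun i => ω (i + m)
    simp only [zero_add, add_assoc, add_comm 1 m] at h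
    rw [pow_succ, mul_right_comm, ih, binaryCode]
    push_cast
    linarith

lemma binaryCode_lt (ω : ℕ → Bool) (m : ℕ) : binaryCode ω m < 2 ^ m := by
  induction m with
  | zero => simp [binaryCode]
  | succ m ih =>
    have := Bool.toNat_le (ω m)
    rw [binaryCode, pow_succ]
    omega

lemma eq_of_binaryCode_eq {ω ω' : ℕ → Bool} {m : ℕ} (h : binaryCode ω m = binaryCode ω' m) :
    ∀ i < m, ω i = ω' i := by
  induction m with
  | zero => simp
  | succ m ih =>
    have h1 := Bool.toNat_le (ω m)
    have h2 := Bool.toNat_le (ω' m)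
    simp only [binaryCode] at h
    intro i hi
    rcases Nat.lt_succ_iff_lt_or_eq.mp hi with hi | rfl
    · exact ih (by omega) i hi
    · cases hω : ω i <;> cases hω' : ω' i <;> simp [hω, hω'] at h ⊢ <;> omega

lemma binaryPoint_lt_one {ω : ℕ → Bool} {i : ℕ} (hi : ω i = false) : binaryPoint ω < 1 := by
  have h := two_pow_mul_binaryPoint ω (i + 1)
  have h1 : binaryCode ω (i + 1) + 2 ≤ 2 ^ (i + 1) := by
    have := binaryCode_lt ω i
    rw [binaryCode, hi, pow_succ]
    simp
    omega
  have h2 : (binaryCode ω (i + 1) : ℝ) + 2 ≤ 2 ^ (i + 1) := by exact_mod_cast h1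
  have h3 := binaryPoint_le_one fun j => ω (j + (i + 1))
  by_contra! hc
  have : (2 : ℝ) ^ (i + 1) ≤ 2 ^ (i + 1) * binaryPoint ω := le_mul_of_one_le_right (by positivity) hc
  linarith

lemma binaryPoint_pos {ω : ℕ → Bool} {i : ℕ} (hi : ω i = true) : 0 < binaryPoint ω := by
  have h := two_pow_mul_binaryPoint ω (i + 1)
  have h1 : 1 ≤ binaryCode ω (i + 1) := by simp [binaryCode, hi]
  have h2 : (1 : ℝ) ≤ binaryCode ω (i + 1) := by exact_mod_cast h1
  have h3 := binaryPoint_nonneg fun j => ω (j + (i + 1))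
  by_contra! hc
  have := mul_nonpos_of_nonneg_of_nonpos (by positivity : (0 : ℝ) ≤ 2 ^ (i + 1)) hc
  linarith

lemma frequently_true_of_frequency {ω : ℕ → Bool} {p : ℝ} (hp : p ≠ 0)
    (h : Tendsto (fun m : ℕ => (trueCount m ω : ℝ) / m) atTop (nhds p)) (n : ℕ) :
    ∃ i, ω (i + n) = true := by
  by_contra! hc
  refine hp (tendsto_nhds_unique h ?_)
  refine tendsto_of_tendsto_of_tendsto_of_le_of_le tendsto_const_nhds
    (tendsto_const_div_atTop_nhds_zero_nat (n : ℝ)) (fun m => by positivity) fun m => ?_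
  have : trueCount m ω ≤ n := by
    calc trueCount m ω ≤ trueCount (m + n) ω :=
          Finset.sum_le_sum_of_subset (Finset.range_mono (by omega))
      _ = trueCount n ω := by
          rw [trueCount, add_comm m n, Finset.sum_range_add, trueCount, Nat.add_eq_left]
          refine Finset.sum_eq_zero fun i _ => ?_
          have := hc i
          rw [add_comm] at this
          simpa using this
      _ ≤ n := trueCount_le n ω
  simp only
  gcongr

lemma frequently_false_of_frequency {ω : ℕ → Bool} {p : ℝ} (hp : p ≠ 1)
    (h : Tendsto (fun m : ℕ => (trueCount m ω : ℝ) / m) atTop (nhds p)) (n : ℕ) :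
    ∃ i, ω (i + n) = false := by
  have key : ∀ m, trueCount m (fun i => !ω i) + trueCount m ω = m := by
    intro m
    rw [trueCount, trueCount, ← Finset.sum_add_distrib]
    calc _ = ∑ _i ∈ Finset.range m, 1 :=
          Finset.sum_congr rfl fun i _ => by cases ω i <;> simp
      _ = m := by simp
  have h' : Tendsto (fun m : ℕ => (trueCount m (fun i => !ω i) : ℝ) / m) atTop (nhds (1 - p)) := by
    refine (tendsto_const_nhds.sub h).congr' ?_
    filter_upwards [eventually_gt_atTop 0] with m hm
    have hm' : (m : ℝ) ≠ 0 := by positivity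
    have : (trueCount m (fun i => !ω i) : ℝ) + trueCount m ω = m := by exact_mod_cast key m
    field_simp
    linarith
  obtain ⟨i, hi⟩ := frequently_true_of_frequency (sub_ne_zero.mpr hp.symm) h' n
  exact ⟨i, by simpa using hi⟩

lemma doublingMap_binaryPoint {ω : ℕ → Bool} (h : binaryPoint (fun i => ω (i + 1)) < 1) :
    doublingMap (binaryPoint ω) = binaryPoint fun i => ω (i + 1) := by
  rw [doublingMap, two_mul_binaryPoint, Int.fract_natCast_add, Int.fract_eq_self]
  exact ⟨binaryPoint_nonneg _, h⟩

lemma half_le_binaryPoint_iff {ω : ℕ → Bool} (h : binaryPoint (fun i => ω (i + 1)) < 1) :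
    1 / 2 ≤ binaryPoint ω ↔ ω 0 = true := by
  have h2 := two_mul_binaryPoint ω
  have h0 := binaryPoint_nonneg fun i => ω (i + 1)
  cases hω : ω 0 <;> simp [hω] at h2 ⊢ <;> linarith

lemma doublingMap_iterate_binaryPoint {ω : ℕ → Bool} (h : ∀ n, ∃ i, ω (i + n) = false) (m : ℕ) :
    doublingMap^[m] (binaryPoint ω) = binaryPoint fun i => ω (i + m) := by
  induction m with
  | zero => simp
  | succ m ih =>
    rw [Function.iterate_succ_apply', ih]
    have := doublingMap_binaryPoint (ω := fun i => ω (i + m)) (by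
      obtain ⟨i, hi⟩ := h (m + 1)
      refine binaryPoint_lt_one (i := i) ?_
      rw [← hi]; congr 1; ring)
    rw [this]
    congr 1 with i
    congr 1
    ring

lemma binaryOnes_card_binaryPoint {ω : ℕ → Bool} (h : ∀ n, ∃ i, ω (i + n) = false) (m : ℕ) :
    (binaryOnes m (binaryPoint ω)).card = trueCount m ω := by
  rw [binaryOnes_card_eq_sum, trueCount]
  refine Finset.sum_congr rfl fun k _ => ?_
  rw [doublingMap_iterate_binaryPoint h]
  have := half_le_binaryPoint_iff (ω := fun i => ω (i + k)) (by
      obtain ⟨i, hi⟩ := h (k + 1)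
      refine binaryPoint_lt_one (i := i) ?_
      rw [← hi]; congr 1; ring)
  simp only [this, zero_add]
  cases ω k <;> simp

lemma binaryPoint_mem_nonDyadic {ω : ℕ → Bool} (h : ∀ n, ∃ i, ω (i + n) = false)
    (h' : ∀ n, ∃ i, ω (i + n) = true) : binaryPoint ω ∈ nonDyadic := by
  refine ⟨⟨binaryPoint_nonneg ω, ?_⟩, fun m => ?_⟩
  · obtain ⟨i, hi⟩ := h 0
    exact binaryPoint_lt_one hi
  · rw [doublingMap_iterate_binaryPoint h]
    obtain ⟨i, hi⟩ := h' m
    exact (binaryPoint_pos (ω := fun i => ω (i + m)) hi).ne'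

/-- The law of a coin showing `true` with probability `p`. -/
noncomputable def coinLaw (p : ℝ) : Measure Bool :=
  ENNReal.ofReal p • Measure.dirac true + ENNReal.ofReal (1 - p) • Measure.dirac false

/-- The law of a sequence of independent coins showing `true` with probability `p`. -/
noncomputable def coinSequenceLaw (p : ℝ) : Measure (ℕ → Bool) :=
  Measure.infinitePi fun _ => coinLaw p

lemma isProbabilityMeasure_coinLaw {p : ℝ} (hp0 : 0 < p) (hp1 : p < 1) :
    IsProbabilityMeasure (coinLaw p) := by
  constructor
  simp only [coinLaw, Measure.add_apply, Measure.smul_apply, measure_univ, smul_eq_mul, mul_one]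
  rw [← ENNReal.ofReal_add hp0.le (by linarith)]
  simp

lemma coinLaw_singleton (p : ℝ) (b : Bool) :
    coinLaw p {b} = ENNReal.ofReal (if b then p else 1 - p) := by
  cases b <;> simp [coinLaw]

lemma ae_tendsto_trueCount {p : ℝ} (hp0 : 0 < p) (hp1 : p < 1) :
    ∀ᵐ ω ∂coinSequenceLaw p,
      Tendsto (fun m : ℕ => (trueCount m ω : ℝ) / m) atTop (nhds p) := by
  have := isProbabilityMeasure_coinLaw hp0 hp1
  have : IsProbabilityMeasure (coinSequenceLaw p) := by unfold coinSequenceLaw; infer_instance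
  let f : Bool → ℝ := fun b => b.toNat
  have hf : Measurable f := measurable_of_countable f
  let X : ℕ → (ℕ → Bool) → ℝ := fun i ω => f (ω i)
  have hmap : ∀ i, (coinSequenceLaw p).map (fun ω => ω i) = coinLaw p := fun i =>
    Measure.infinitePi_map_eval (fun _ : ℕ => coinLaw p) i
  have hX : ∀ i, Measurable (X i) := fun i => hf.comp (measurable_pi_apply i)
  have hint : Integrable (X 0) (coinSequenceLaw p) := by
    refine Integrable.of_bound (hX 0).aestronglyMeasurable 1 (Eventually.of_forall fun ω => ?_)
    rw [Real.norm_of_nonneg (by positivity)]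
    simp only [X, f]
    exact_mod_cast Bool.toNat_le (ω 0)
  have hindep : Pairwise
      (Function.onFun (fun f g => ProbabilityTheory.IndepFun f g (coinSequenceLaw p)) X) :=
    fun i j hij => (ProbabilityTheory.iIndepFun_infinitePi (P := fun _ : ℕ => coinLaw p)
      (X := fun _ => f) fun _ => hf).indepFun hij
  have hident : ∀ i, ProbabilityTheory.IdentDistrib (X i) (X 0)
      (coinSequenceLaw p) (coinSequenceLaw p) := by
    refine fun i => ⟨(hX i).aemeasurable, (hX 0).aemeasurable, ?_⟩
    have : ∀ i, (coinSequenceLaw p).map (X i) = (coinLaw p).map f := fun i => by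
      rw [← hmap i, Measure.map_map hf (measurable_pi_apply i)]
      rfl
    rw [this, this]
  have hmean : ∫ ω, X 0 ω ∂coinSequenceLaw p = p := by
    have h1 : ∫ ω, X 0 ω ∂coinSequenceLaw p = ∫ b, f b ∂coinLaw p := by
      rw [← hmap 0, integral_map (measurable_pi_apply 0).aemeasurable hf.aestronglyMeasurable]
    rw [h1, integral_fintype (.of_finite)]
    simp [Measure.real, coinLaw_singleton, f, hp0.le]
  have := ProbabilityTheory.strong_law_ae_real X hint hindep hident
  rw [hmean] at this
  filter_upwards [this] with ω hω
  simpa [trueCount, X, f] using hω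

lemma coinSequenceLaw_cylinder {p : ℝ} (hp0 : 0 < p) (hp1 : p < 1) (ω : ℕ → Bool) (m : ℕ) :
    coinSequenceLaw p {ω' | ∀ i < m, ω' i = ω i} =
      ENNReal.ofReal (p ^ trueCount m ω * (1 - p) ^ (m - trueCount m ω)) := by
  have := isProbabilityMeasure_coinLaw hp0 hp1
  have hset : {ω' : ℕ → Bool | ∀ i < m, ω' i = ω i} =
      Set.pi (Finset.range m : Set ℕ) fun i => {ω i} := by
    ext ω'
    simp [Set.mem_pi]
  rw [hset, coinSequenceLaw, Measure.infinitePi_pi _ fun i _ => measurableSet_singleton _]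
  simp only [coinLaw_singleton]
  have hnn : ∀ b : Bool, 0 ≤ if b then p else 1 - p := by
    intro b
    cases b <;> simp <;> linarith
  rw [← ENNReal.ofReal_prod_of_nonneg fun i _ => hnn _]
  congr 1
  induction m with
  | zero => simp [trueCount]
  | succ m ih =>
    have hle := trueCount_le m ω
    have hs : trueCount (m + 1) ω = trueCount m ω + (ω m).toNat := Finset.sum_range_succ _ _
    rw [Finset.prod_range_succ, ih (by ext; simp [Set.mem_pi]), hs]
    cases ω m
    · simp only [Bool.toNat_false, add_zero, Nat.sub_add_comm hle, pow_succ, Bool.false_eq_true,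
        if_false]
      ring
    · simp only [Bool.toNat_true, Nat.add_sub_add_right, pow_succ, if_true]
      ring

/-- The sequences whose cylinders of every depth `m ≥ M` have `coinSequenceLaw p`-measure at most
`2 ^ (-m * s)`. -/
def smallCylinders (p s : ℝ) (M : ℕ) : Set (ℕ → Bool) :=
  {ω | ∀ m ≥ M, p ^ trueCount m ω * (1 - p) ^ (m - trueCount m ω) ≤ ((1 / 2 : ℝ) ^ m) ^ s}

lemma coinSequenceLaw_binaryCode_eq_le {p s : ℝ} (hp0 : 0 < p) (hp1 : p < 1) {M m : ℕ}
    (hm : M ≤ m) (k : ℕ) :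
    coinSequenceLaw p ({ω | binaryCode ω m = k} ∩ smallCylinders p s M) ≤
      ENNReal.ofReal (((1 / 2 : ℝ) ^ m) ^ s) := by
  rcases ({ω | binaryCode ω m = k} ∩ smallCylinders p s M).eq_empty_or_nonempty with h | ⟨ω, h1, h2⟩
  · rw [h]; simp
  · calc _ ≤ coinSequenceLaw p {ω' | ∀ i < m, ω' i = ω i} :=
          measure_mono fun ω' hω' => eq_of_binaryCode_eq (hω'.1.trans h1.symm)
      _ ≤ _ := by
          rw [coinSequenceLaw_cylinder hp0 hp1]
          exact ENNReal.ofReal_le_ofReal (h2 m hm)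

lemma coinSequenceLaw_closedBall_le {p s : ℝ} (hp0 : 0 < p) (hp1 : p < 1) {M m : ℕ}
    (hm : M ≤ m) (x : ℝ) {r : ℝ} (hr : r ≤ (1 / 2) ^ m) :
    coinSequenceLaw p (binaryPoint ⁻¹' Metric.closedBall x r ∩ smallCylinders p s M) ≤
      4 * ENNReal.ofReal (((1 / 2 : ℝ) ^ m) ^ s) := by
  let a : ℤ := ⌈2 ^ m * (x - r)⌉ - 1
  have hsub : binaryPoint ⁻¹' Metric.closedBall x r ∩ smallCylinders p s M ⊆
      ⋃ k ∈ Finset.Icc a (a + 3), {ω | binaryCode ω m = k.toNat} ∩ smallCylinders p s M := by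
    rintro ω ⟨hω, hG⟩
    have hb := two_pow_mul_binaryPoint ω m
    have h0 := binaryPoint_nonneg fun i => ω (i + m)
    have h1 := binaryPoint_le_one fun i => ω (i + m)
    rw [mem_preimage, Real.closedBall_eq_Icc, mem_Icc] at hω
    have hpos : (0 : ℝ) < 2 ^ m := by positivity
    have hl := mul_le_mul_of_nonneg_left hω.1 hpos.le
    have hu := mul_le_mul_of_nonneg_left hω.2 hpos.le
    have hr' : 2 ^ m * r ≤ 1 := by
      calc (2 : ℝ) ^ m * r ≤ 2 ^ m * (1 / 2) ^ m := by gcongr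
        _ = 1 := by rw [← mul_pow]; norm_num
    have hc := Int.le_ceil ((2 : ℝ) ^ m * (x - r))
    refine mem_biUnion (x := (binaryCode ω m : ℤ)) ?_ ⟨by simp, hG⟩
    rw [SetLike.mem_coe, Finset.mem_Icc]
    constructor
    · have : ⌈(2 : ℝ) ^ m * (x - r)⌉ ≤ (binaryCode ω m : ℤ) + 1 := by
        rw [Int.ceil_le]
        push_cast
        linarith
      simp only [a]
      omega
    · have : ((binaryCode ω m : ℤ) : ℝ) ≤ ((⌈(2 : ℝ) ^ m * (x - r)⌉ + 2 : ℤ) : ℝ) := by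
        push_cast
        nlinarith
      have := Int.cast_le.mp this
      simp only [a]
      omega
  calc _ ≤ _ := measure_mono hsub
    _ ≤ ∑ k ∈ Finset.Icc a (a + 3), coinSequenceLaw p
          ({ω | binaryCode ω m = k.toNat} ∩ smallCylinders p s M) := measure_biUnion_finset_le _ _
    _ ≤ ∑ _k ∈ Finset.Icc a (a + 3), ENNReal.ofReal (((1 / 2 : ℝ) ^ m) ^ s) :=
        Finset.sum_le_sum fun k _ => coinSequenceLaw_binaryCode_eq_le hp0 hp1 hm _
    _ = _ := by
        have : a + 3 + 1 - a = 4 := by ring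
        simp [this]

lemma coinSequenceLaw_closedBall_le_rpow {p s : ℝ} (hp0 : 0 < p) (hp1 : p < 1) (hs : 0 < s)
    {M : ℕ} (x : ℝ) {r : ℝ} (hr0 : 0 ≤ r) (hr : r < (1 / 2) ^ M) :
    coinSequenceLaw p (binaryPoint ⁻¹' Metric.closedBall x r ∩ smallCylinders p s M) ≤
      ENNReal.ofReal (4 * 2 ^ s) * ENNReal.ofReal r ^ s := by
  have key : ∀ r : ℝ, 0 < r → r < (1 / 2) ^ M →
      coinSequenceLaw p (binaryPoint ⁻¹' Metric.closedBall x r ∩ smallCylinders p s M) ≤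
        ENNReal.ofReal (4 * 2 ^ s * r ^ s) := by
    intro r hr0 hr
    obtain ⟨m, h1, h2⟩ := exists_nat_pow_near_of_lt_one hr0
      (hr.le.trans (pow_le_one₀ (by norm_num) (by norm_num))) (by norm_num : (0 : ℝ) < 1 / 2)
      (by norm_num)
    have hm : M ≤ m := by
      have := (pow_lt_pow_iff_right_of_lt_one₀ (by norm_num : (0 : ℝ) < 1 / 2)
        (by norm_num)).mp (h1.trans hr)
      omega
    refine (coinSequenceLaw_closedBall_le hp0 hp1 hm x h2).trans ?_
    have h4 : (4 : ENNReal) = ENNReal.ofReal 4 := by simp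
    rw [h4, ← ENNReal.ofReal_mul (by norm_num), mul_assoc, ← Real.mul_rpow (by norm_num) hr0.le]
    refine ENNReal.ofReal_le_ofReal ?_
    gcongr
    rw [pow_succ] at h1
    linarith
  have hlim : Tendsto (fun r : ℝ => ENNReal.ofReal (4 * 2 ^ s * r ^ s)) (nhdsWithin r (Ioi r))
      (nhds (ENNReal.ofReal (4 * 2 ^ s * r ^ s))) := by
    refine (ENNReal.continuous_ofReal.comp ?_).continuousAt.continuousWithinAt
    exact continuous_const.mul (Real.continuous_rpow_const hs.le)
  rw [ENNReal.ofReal_rpow_of_nonneg hr0 hs.le, ← ENNReal.ofReal_mul (by positivity)]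
  refine ge_of_tendsto hlim ?_
  filter_upwards [Ioo_mem_nhdsGT hr] with r' hr'
  refine (measure_mono ?_).trans (key r' (hr0.trans_lt hr'.1) hr'.2)
  gcongr
  exact hr'.1.le

lemma le_dimH_frequency {p : ℝ} (hp0 : 0 < p) (hp1 : p < 1) :
    ENNReal.ofReal (Real.binEntropy p / Real.log 2) ≤
      dimH {x ∈ nonDyadic |
        Tendsto (fun m : ℕ => ((binaryOnes m x).card : ℝ) / m) atTop (nhds p)} := by
  set E := {x ∈ nonDyadic |
        Tendsto (fun m : ℕ => ((binaryOnes m x).card : ℝ) / m) atTop (nhds p)}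
  have := isProbabilityMeasure_coinLaw hp0 hp1
  have : IsProbabilityMeasure (coinSequenceLaw p) := by unfold coinSequenceLaw; infer_instance
  refine ENNReal.le_of_forall_nnreal_lt fun s hs => ?_
  rcases eq_or_lt_of_le (zero_le (a := s)) with rfl | hs0
  · simp
  have hs0' : (0 : ℝ) < s := hs0
  have hlog : 0 < Real.log 2 := Real.log_pos (by norm_num)
  have hs' : s * Real.log 2 < Real.binEntropy p := by
    rw [← ENNReal.ofReal_coe_nnreal] at hs
    exact (lt_div_iff₀ hlog).mp ((ENNReal.ofReal_lt_ofReal_iff'.mp hs).1)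
  have hae := ae_tendsto_trueCount hp0 hp1
  have hpre : ∀ᵐ ω ∂coinSequenceLaw p, ω ∈ binaryPoint ⁻¹' E := by
    filter_upwards [hae] with ω hω
    have hf := frequently_false_of_frequency hp1.ne hω
    have ht := frequently_true_of_frequency hp0.ne' hω
    exact ⟨binaryPoint_mem_nonDyadic hf ht, by simpa only [binaryOnes_card_binaryPoint hf] using hω⟩
  obtain ⟨M, hM⟩ : ∃ M, coinSequenceLaw p (smallCylinders p s M) ≠ 0 := by
    by_contra! hc
    have h0 : coinSequenceLaw p (⋃ M, smallCylinders p s M) = 0 := measure_iUnion_null hc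
    have h1 : ∀ᵐ ω ∂coinSequenceLaw p, ω ∈ ⋃ M, smallCylinders p s M := by
      filter_upwards [hae] with ω hω
      obtain ⟨M, hM⟩ := eventually_atTop.mp (eventually_weight_le_half_pow hp0 hp1 hs'
        (fun m => trueCount_le m ω) hω)
      exact mem_iUnion.mpr ⟨M, hM⟩
    have := prob_compl_eq_zero_iff₀ (NullMeasurableSet.of_null h0) |>.mp h1
    rw [h0] at this
    exact zero_ne_one this
  let ν : Measure ℝ := ((coinSequenceLaw p).restrict (smallCylinders p s M)).map binaryPoint
  let C : ENNReal := ENNReal.ofReal (4 * 2 ^ (s : ℝ))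
  have hC0 : C ≠ 0 := (ENNReal.ofReal_pos.mpr (by positivity)).ne'
  have hCt : C ≠ ⊤ := ENNReal.ofReal_ne_top
  have hball : ∀ (x r : ℝ), 0 ≤ r → r < (1 / 2) ^ M →
      ν (Metric.closedBall x r) ≤ C * ENNReal.ofReal r ^ (s : ℝ) := by
    intro x r hr0 hr
    rw [Measure.map_apply measurable_binaryPoint Metric.isClosed_closedBall.measurableSet,
      Measure.restrict_apply (measurable_binaryPoint Metric.isClosed_closedBall.measurableSet)]
    exact coinSequenceLaw_closedBall_le_rpow hp0 hp1 hs0' x hr0 hr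
  have hle : C⁻¹ • ν ≤ μH[s] := by
    refine Measure.le_hausdorffMeasure s _ (ENNReal.ofReal ((1 / 2) ^ (M + 1)))
      (ENNReal.ofReal_pos.mpr (by positivity)) fun U hU => ?_
    rcases U.eq_empty_or_nonempty with rfl | ⟨x, hx⟩
    · simp
    have htop : Metric.ediam U ≠ ⊤ := ne_top_of_le_ne_top ENNReal.ofReal_ne_top hU
    have hr : (Metric.ediam U).toReal < (1 / 2) ^ M := by
      refine (ENNReal.toReal_le_of_le_ofReal (by positivity) hU).trans_lt ?_
      exact pow_lt_pow_right_of_lt_one₀ (by norm_num) (by norm_num) (by omega)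
    have hsub : U ⊆ Metric.closedBall x (Metric.ediam U).toReal := by
      intro y hy
      rw [Metric.mem_closedBall, dist_edist]
      exact ENNReal.toReal_mono htop (Metric.edist_le_ediam_of_mem hy hx)
    have := (measure_mono hsub).trans (hball x _ ENNReal.toReal_nonneg hr)
    rw [ENNReal.ofReal_toReal htop] at this
    rw [Measure.smul_apply, smul_eq_mul]
    exact (ENNReal.inv_mul_le_iff hC0 hCt).mpr this
  refine le_dimH_of_hausdorffMeasure_ne_zero fun h0 => hM ?_
  have hν : ν E = 0 := by
    have := hle E
    rw [h0, Measure.smul_apply, smul_eq_mul, nonpos_iff_eq_zero, mul_eq_zero] at this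
    exact this.resolve_left (ENNReal.inv_ne_zero.mpr hCt)
  have hres : (coinSequenceLaw p).restrict (smallCylinders p s M) (binaryPoint ⁻¹' E) = 0 :=
    nonpos_iff_eq_zero.mp
      ((Measure.le_map_apply measurable_binaryPoint.aemeasurable E).trans hν.le)
  have hall : ∀ᵐ ω ∂(coinSequenceLaw p).restrict (smallCylinders p s M), ω ∈ binaryPoint ⁻¹' E :=
    ae_restrict_of_ae hpre
  rw [← Measure.restrict_apply_univ, ← measure_congr (eventuallyEq_univ.mpr hall)]
  exact hres

lemma binEntropy_inv {ξ : ℝ} (hξ : 1 < ξ) :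
    Real.binEntropy ξ⁻¹ = Real.log (ξ - 1) / ξ + Real.log ξ - Real.log (ξ - 1) := by
  have h0 : ξ ≠ 0 := by positivity
  have h1 : ξ - 1 ≠ 0 := by linarith
  have e : 1 - ξ⁻¹ = (ξ - 1) / ξ := by field_simp
  rw [Real.binEntropy, e, inv_inv, inv_div, Real.log_div h0 h1]
  field_simp
  ring

theorem khinchine_spectrum (ξ : ℝ) (hξ : 1 < ξ) :
    dimH (khinchinLevelSet ξ) =
      ENNReal.ofReal
        ((Real.log (ξ - 1) / ξ + Real.log ξ - Real.log (ξ - 1)) / Real.log 2) := by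
  have hξ0 : 0 < ξ := by linarith
  have hp0 : 0 < ξ⁻¹ := inv_pos.mpr hξ0
  have hp1 : ξ⁻¹ < 1 := inv_lt_one_of_one_lt₀ hξ
  rw [← binEntropy_inv hξ]
  apply le_antisymm
  · have hsub : khinchinLevelSet ξ ⊆ {x ∈ Ico (0 : ℝ) 1 |
        Tendsto (fun m : ℕ => ((binaryOnes m x).card : ℝ) / m) atTop (nhds ξ⁻¹)} ∪
        ((Ico (0 : ℝ) 1 \ nonDyadic) ∪ {1}) := by
      intro x hx
      by_cases hx' : x ∈ nonDyadic
      · exact Or.inl ⟨hx'.1, (khinchine_iff_frequency hx' hξ0).mp hx⟩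
      · rcases hx.1.2.lt_or_eq with h | h
        · exact Or.inr (Or.inl ⟨⟨hx.1.1.le, h⟩, hx'⟩)
        · exact Or.inr (Or.inr h)
    refine (dimH_mono hsub).trans ?_
    rw [dimH_union, dimH_countable (countable_Ico_diff_nonDyadic.union (countable_singleton 1))]
    exact max_le (dimH_frequency_le hp0 hp1) zero_le
  · refine (le_dimH_frequency hp0 hp1).trans (dimH_mono ?_)
    rintro x ⟨hx, hlim⟩
    exact (khinchine_iff_frequency hx hξ0).mpr hlim
end

section
/- The Hausdorff dimension of the level set E(1) = {x ∈ (0,1] : lim_{n→∞} (1/n) ∑_{j=1}^{n} d_j(x) = 1} is 0. -/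
open MeasureTheory Filter Real Set

/-- The zero-based branch index of `p2gleT` at `x`. -/
noncomputable def p2gleBranch (x : ℝ) : ℤ := ⌊-Real.logb 2 x⌋

lemma p2gleBranch_nonneg {x : ℝ} (hx : x ∈ Ioc (0:ℝ) 1) : 0 ≤ p2gleBranch x :=
  Int.floor_nonneg.2 (neg_nonneg.2 (Real.logb_nonpos (by norm_num) hx.1.le hx.2))

lemma p2gleT_mem_Ioc {x : ℝ} (hx : 0 < x) : p2gleT x ∈ Ioc (0:ℝ) 1 := by
  have h2 : (2:ℝ) ^ Real.logb 2 x = x := Real.rpow_logb (by norm_num) (by norm_num) hx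
  have key : (2:ℝ) ^ (⌊-Real.logb 2 x⌋ + 1) * x
      = 2 ^ ((⌊-Real.logb 2 x⌋ : ℝ) + 1 + Real.logb 2 x) := by
    rw [Real.rpow_add (by norm_num), h2]
    congr 1
    rw [← Real.rpow_intCast]
    push_cast
    rfl
  have h3 := Int.floor_le (-Real.logb 2 x)
  have h4 := Int.lt_floor_add_one (-Real.logb 2 x)
  have h5 : (1:ℝ) < 2 ^ ((⌊-Real.logb 2 x⌋ : ℝ) + 1 + Real.logb 2 x) :=
    Real.one_lt_rpow (by norm_num) (by linarith)
  have h6 : (2:ℝ) ^ ((⌊-Real.logb 2 x⌋ : ℝ) + 1 + Real.logb 2 x) ≤ 2 ^ (1:ℝ) :=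
    Real.rpow_le_rpow_of_exponent_le (by norm_num) (by linarith)
  rw [Real.rpow_one] at h6
  unfold p2gleT
  rw [key]
  constructor <;> linarith

lemma p2gleT_iterate_mem_Ioc {x : ℝ} (hx : x ∈ Ioc (0:ℝ) 1) (j : ℕ) :
    p2gleT^[j] x ∈ Ioc (0:ℝ) 1 := by
  induction j with
  | zero => exact hx
  | succ j ih =>
    rw [Function.iterate_succ_apply']
    exact p2gleT_mem_Ioc ih.1

lemma p2gleT_one : p2gleT 1 = 1 := by
  norm_num [p2gleT]

/-- Points sharing their first `N` branches are within `2⁻ᴺ` of each other. -/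
lemma abs_sub_le_of_p2gleBranch_eq (N : ℕ) :
    ∀ x ∈ Ioc (0:ℝ) 1, ∀ y ∈ Ioc (0:ℝ) 1,
      (∀ j < N, p2gleBranch (p2gleT^[j] x) = p2gleBranch (p2gleT^[j] y)) →
      |x - y| ≤ (1 / 2) ^ N := by
  induction N with
  | zero =>
    intro x hx y hy _
    rw [abs_le]
    constructor <;> linarith [hx.1, hx.2, hy.1, hy.2]
  | succ N ih =>
    intro x hx y hy h
    have h0 : p2gleBranch x = p2gleBranch y := h 0 (Nat.succ_pos N)
    have hT : p2gleT x - p2gleT y = 2 ^ (p2gleBranch x + 1) * (x - y) := by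
      have : p2gleT y = 2 ^ (p2gleBranch x + 1) * y - 1 := by rw [h0]; rfl
      rw [this]
      change 2 ^ (p2gleBranch x + 1) * x - 1 - _ = _
      ring
    have hd := ih _ (p2gleT_mem_Ioc hx.1) _ (p2gleT_mem_Ioc hy.1)
      (fun j hj => h (j + 1) (Nat.succ_lt_succ hj))
    have h2 : (2:ℝ) ≤ 2 ^ (p2gleBranch x + 1) := by
      have := zpow_le_zpow_right₀ (a := (2:ℝ)) (by norm_num)
        (show (1:ℤ) ≤ p2gleBranch x + 1 by linarith [p2gleBranch_nonneg hx])
      simpa using this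
    rw [hT, abs_mul, abs_of_pos (by linarith : (0:ℝ) < 2 ^ (p2gleBranch x + 1))] at hd
    have := mul_le_mul_of_nonneg_right h2 (abs_nonneg (x - y))
    rw [pow_succ]
    linarith

/-- Orbits of points in the level set of a nonzero exponent avoid the powers of two, where the
digit and the branch index of the map disagree. -/
lemma p2gleD_eq_p2gleBranch_add_one {ξ : ℝ} (hξ : ξ ≠ 0) {x : ℝ}
    (hx : x ∈ khinchinLevelSet ξ) (j : ℕ) :
    p2gleD j x = p2gleBranch (p2gleT^[j] x) + 1 := by
  by_contra hne
  set y := p2gleT^[j] x with hy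
  have hy0 : 0 < y := (p2gleT_iterate_mem_Ioc hx.1 j).1
  have hceil : ⌈-Real.logb 2 y⌉ ≠ ⌊-Real.logb 2 y⌋ + 1 := hne
  have hint : -Real.logb 2 y = ⌊-Real.logb 2 y⌋ := by
    have h1 := Int.ceil_le_floor_add_one (-Real.logb 2 y)
    have h2 : ⌈-Real.logb 2 y⌉ ≤ ⌊-Real.logb 2 y⌋ := by omega
    exact le_antisymm (Int.ceil_le.1 h2) (Int.floor_le _)
  have hyT : p2gleT y = 1 := by
    unfold p2gleT
    have : y = 2 ^ (-⌊-Real.logb 2 y⌋) := by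
      rw [← Real.rpow_intCast]
      push_cast
      rw [← hint, neg_neg, Real.rpow_logb (by norm_num) (by norm_num) hy0]
    nth_rewrite 2 [this]
    rw [← zpow_add₀ (by norm_num)]
    norm_num
  have hfix : ∀ i, p2gleT^[i + (j + 1)] x = 1 := by
    intro i
    rw [Function.iterate_add_apply, Function.iterate_succ_apply', ← hy, hyT]
    exact Function.iterate_fixed p2gleT_one i
  have hzero : ∀ i, j + 1 ≤ i → (p2gleD i x : ℝ) = 0 := by
    intro i hi
    obtain ⟨k, rfl⟩ := Nat.exists_eq_add_of_le' hi
    simp [p2gleD, hfix k]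
  have hlim : Tendsto (fun n : ℕ => (∑ i ∈ Finset.range n, (p2gleD i x : ℝ)) / n) atTop
      (nhds 0) := by
    refine (tendsto_const_div_atTop_nhds_zero_nat
      (∑ i ∈ Finset.range (j + 1), (p2gleD i x : ℝ))).congr' ?_
    filter_upwards [eventually_ge_atTop (j + 1)] with n hn
    congr 1
    refine Finset.sum_subset (Finset.range_mono hn) fun i _ hi => hzero i ?_
    simpa using hi
  exact hξ (tendsto_nhds_unique hx.2 hlim)

/-- Points all of whose branch averages over at least `m` steps are at most `ε`. -/
def p2gleLowBranchSet (ε : ℝ) (m : ℕ) : Set ℝ :=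
  {x ∈ Ioc (0:ℝ) 1 |
    ∀ n ≥ m, ∑ j ∈ Finset.range n, (p2gleBranch (p2gleT^[j] x) : ℝ) ≤ ε * n}

lemma khinchinLevelSet_one_subset {ε : ℝ} (hε : 0 < ε) :
    khinchinLevelSet 1 ⊆ ⋃ m, p2gleLowBranchSet ε m := by
  intro x hx
  obtain ⟨m, hm⟩ := eventually_atTop.1
    (hx.2.eventually (gt_mem_nhds (show (1:ℝ) < 1 + ε by linarith)))
  refine mem_iUnion.2 ⟨m, hx.1, fun n hn => ?_⟩
  rcases Nat.eq_zero_or_pos n with rfl | hpos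
  · simp
  have h := hm n hn
  rw [div_lt_iff₀ (by exact_mod_cast hpos)] at h
  simp only [p2gleD_eq_p2gleBranch_add_one one_ne_zero hx, Int.cast_add, Int.cast_one,
    Finset.sum_add_distrib, Finset.sum_const, Finset.card_range, nsmul_eq_mul, mul_one] at h
  linarith

/-- The cylinder of branches `c`, replaced by `∅` when the branches have average above `ε`. -/
def p2gleLowCylinder (ε : ℝ) (N : ℕ) (c : Fin N → Fin (N + 1)) : Set ℝ :=
  {x ∈ Ioc (0:ℝ) 1 | (∀ j : Fin N, p2gleBranch (p2gleT^[j] x) = (c j : ℕ)) ∧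
    ((∑ j, (c j : ℕ) : ℕ) : ℝ) ≤ ε * N}

lemma p2gleLowBranchSet_subset_iUnion {ε : ℝ} (hε : ε ≤ 1) {m N : ℕ} (hN : m ≤ N) :
    p2gleLowBranchSet ε m ⊆ ⋃ c, p2gleLowCylinder ε N c := by
  intro x hx
  have hnn : ∀ j, 0 ≤ p2gleBranch (p2gleT^[j] x) := fun j =>
    p2gleBranch_nonneg (p2gleT_iterate_mem_Ioc hx.1 j)
  have hsum := hx.2 N hN
  have hle : ∀ j : Fin N, p2gleBranch (p2gleT^[j] x) ≤ N := by
    intro j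
    have h1 : (p2gleBranch (p2gleT^[j] x) : ℝ)
        ≤ ∑ i ∈ Finset.range N, (p2gleBranch (p2gleT^[i] x) : ℝ) :=
      Finset.single_le_sum (f := fun i => (p2gleBranch (p2gleT^[i] x) : ℝ))
        (fun i _ => by exact_mod_cast hnn i) (Finset.mem_range.2 j.2)
    have h2 : ε * N ≤ 1 * N := mul_le_mul_of_nonneg_right hε (Nat.cast_nonneg N)
    have h3 : (p2gleBranch (p2gleT^[j] x) : ℝ) ≤ (N : ℝ) := by linarith
    exact_mod_cast h3
  refine mem_iUnion.2 ⟨fun j => ⟨(p2gleBranch (p2gleT^[j] x)).toNat, ?_⟩, hx.1, ?_, ?_⟩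
  · have := hle j
    have := hnn j
    omega
  · intro j
    exact (Int.toNat_of_nonneg (hnn j)).symm
  · refine le_trans (le_of_eq ?_) hsum
    rw [Finset.sum_range, Nat.cast_sum]
    refine Finset.sum_congr rfl fun j _ => ?_
    have := Int.toNat_of_nonneg (hnn j)
    exact_mod_cast this

lemma ediam_p2gleLowCylinder_le (ε : ℝ) (N : ℕ) (c : Fin N → Fin (N + 1)) :
    Metric.ediam (p2gleLowCylinder ε N c) ≤ ENNReal.ofReal ((1 / 2) ^ N) := by
  refine Metric.ediam_le fun x hx y hy => ?_
  rw [edist_dist, Real.dist_eq]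
  refine ENNReal.ofReal_le_ofReal (abs_sub_le_of_p2gleBranch_eq N x hx.1 y hy.1 fun j hj => ?_)
  rw [hx.2.1 ⟨j, hj⟩, hy.2.1 ⟨j, hj⟩]

lemma ediam_p2gleLowCylinder_rpow_le {ε s r : ℝ} (hs : 0 < s) (hr : 0 < r) (hr1 : r < 1)
    (N : ℕ) (c : Fin N → Fin (N + 1)) :
    Metric.ediam (p2gleLowCylinder ε N c) ^ s
      ≤ ENNReal.ofReal (((1 / 2) ^ s * r ^ (-ε)) ^ N * ∏ j, r ^ (c j : ℕ)) := by
  rcases (p2gleLowCylinder ε N c).eq_empty_or_nonempty with he | ⟨x, hx⟩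
  · simp [he, hs]
  have hc := hx.2.2
  calc Metric.ediam (p2gleLowCylinder ε N c) ^ s
      ≤ ENNReal.ofReal ((1 / 2) ^ N) ^ s :=
        ENNReal.rpow_le_rpow (ediam_p2gleLowCylinder_le ε N c) hs.le
    _ = ENNReal.ofReal (((1 / 2) ^ s) ^ N) := by
        rw [ENNReal.ofReal_rpow_of_nonneg (by positivity) hs.le, ← Real.rpow_natCast,
          ← Real.rpow_natCast, ← Real.rpow_mul (by norm_num), ← Real.rpow_mul (by norm_num),
          mul_comm]
    _ ≤ _ := by
        refine ENNReal.ofReal_le_ofReal ?_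
        rw [mul_pow, mul_assoc]
        refine le_mul_of_one_le_right (by positivity) ?_
        rw [Finset.prod_pow_eq_pow_sum, ← Real.rpow_natCast r, ← Real.rpow_natCast (r ^ (-ε)),
          ← Real.rpow_mul hr.le, ← Real.rpow_add hr]
        exact Real.one_le_rpow_of_pos_of_le_one_of_nonpos hr hr1.le (by linarith)

lemma sum_ediam_p2gleLowCylinder_rpow_le {ε s r : ℝ} (hs : 0 < s) (hr : 0 < r) (hr1 : r < 1)
    (N : ℕ) :
    ∑ c, Metric.ediam (p2gleLowCylinder ε N c) ^ s
      ≤ ENNReal.ofReal (((1 / 2) ^ s * r ^ (-ε) * (1 - r)⁻¹) ^ N) := by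
  refine (Finset.sum_le_sum fun c _ => ediam_p2gleLowCylinder_rpow_le hs hr hr1 N c).trans ?_
  rw [← ENNReal.ofReal_sum_of_nonneg fun c _ => by positivity]
  refine ENNReal.ofReal_le_ofReal ?_
  rw [← Finset.mul_sum, ← Fintype.sum_pow (fun k : Fin (N + 1) => r ^ (k : ℕ)) N,
    mul_pow _ (1 - r)⁻¹]
  have hgeom : ∑ k : Fin (N + 1), r ^ (k : ℕ) ≤ (1 - r)⁻¹ := by
    rw [← Finset.sum_range (fun k => r ^ k), ← tsum_geometric_of_lt_one hr.le hr1]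
    exact (summable_geometric_of_lt_one hr.le hr1).sum_le_tsum _ fun k _ => by positivity
  gcongr

lemma hausdorffMeasure_p2gleLowBranchSet {ε s r : ℝ} (hε : ε ≤ 1) (hs : 0 < s) (hr : 0 < r)
    (hr1 : r < 1) (hlt : (1 / 2) ^ s * r ^ (-ε) * (1 - r)⁻¹ < 1) (m : ℕ) :
    Measure.hausdorffMeasure s (p2gleLowBranchSet ε m) = 0 := by
  have h1r : 0 < 1 - r := sub_pos.2 hr1
  have hhalf : Tendsto (fun N : ℕ => ENNReal.ofReal ((1 / 2 : ℝ) ^ N)) atTop (nhds 0) := by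
    simpa using ENNReal.tendsto_ofReal
      (tendsto_pow_atTop_nhds_zero_of_lt_one (r := (1 / 2 : ℝ)) (by norm_num) (by norm_num))
  have hq : Tendsto (fun N : ℕ => ENNReal.ofReal (((1 / 2) ^ s * r ^ (-ε) * (1 - r)⁻¹) ^ N))
      atTop (nhds 0) := by
    simpa using ENNReal.tendsto_ofReal
      (tendsto_pow_atTop_nhds_zero_of_lt_one (by positivity) hlt)
  have hsum : Tendsto (fun N : ℕ => ∑ c, Metric.ediam (p2gleLowCylinder ε N c) ^ s)
      atTop (nhds 0) :=
    tendsto_of_tendsto_of_tendsto_of_le_of_le tendsto_const_nhds hq (fun _ => zero_le)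
      fun N => sum_ediam_p2gleLowCylinder_rpow_le hs hr hr1 N
  refine le_antisymm ?_ zero_le
  rw [← hsum.liminf_eq]
  exact Measure.hausdorffMeasure_le_liminf_sum s _ _ hhalf (p2gleLowCylinder ε)
    (Eventually.of_forall fun N c => ediam_p2gleLowCylinder_le ε N c)
    ((eventually_ge_atTop m).mono fun N hN => p2gleLowBranchSet_subset_iUnion hε hN)

lemma exists_rpow_mul_rpow_mul_inv_lt_one {s : ℝ} (hs : 0 < s) :
    ∃ r ε : ℝ, 0 < r ∧ r < 1 ∧ 0 < ε ∧ ε ≤ 1 ∧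
      (1 / 2 : ℝ) ^ s * r ^ (-ε) * (1 - r)⁻¹ < 1 := by
  set a : ℝ := (1 / 2) ^ s with ha
  have ha0 : 0 < a := by positivity
  have ha1 : a < 1 := Real.rpow_lt_one (by norm_num) (by norm_num) hs
  have hr : 0 < (1 - a) / 2 := by linarith
  have hcont : Continuous fun ε : ℝ => a * ((1 - a) / 2) ^ (-ε) * (1 - (1 - a) / 2)⁻¹ :=
    (continuous_const.mul
      (continuous_const.rpow continuous_neg fun _ => Or.inl hr.ne')).mul continuous_const
  have hlim := hcont.tendsto 0
  have h0 : a * ((1 - a) / 2) ^ (-(0:ℝ)) * (1 - (1 - a) / 2)⁻¹ < 1 := by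
    rw [neg_zero, Real.rpow_zero, mul_one, ← div_eq_mul_inv, div_lt_one (by linarith)]
    linarith
  have hev := (hlim.eventually (gt_mem_nhds h0)).filter_mono
    (nhdsWithin_le_nhds (s := Ioi (0:ℝ)))
  obtain ⟨ε, h1, h2⟩ := (hev.and (Ioc_mem_nhdsGT (zero_lt_one' ℝ))).exists
  exact ⟨(1 - a) / 2, ε, hr, by linarith, h2.1, h2.2, h1⟩

theorem dimH_khinchine_one : dimH (khinchinLevelSet 1) = 0 := by
  refine le_antisymm (dimH_le fun s hs => ?_) zero_le
  by_contra hpos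
  have hs0 : 0 < (s : ℝ) := by
    have : 0 < s := by simpa [pos_iff_ne_zero] using hpos
    exact_mod_cast this
  obtain ⟨r, ε, hr, hr1, hε, hε1, hlt⟩ := exists_rpow_mul_rpow_mul_inv_lt_one hs0
  have hzero : Measure.hausdorffMeasure (s : ℝ) (khinchinLevelSet 1) = 0 :=
    measure_mono_null (khinchinLevelSet_one_subset hε)
      (measure_iUnion_null fun m => hausdorffMeasure_p2gleLowBranchSet hε1 hs0 hr hr1 hlt m)
  simp [hzero] at hs
end

section
/- For Lebesgue-almost every x ∈ (0,1], the Khintchine exponent exists and equals 2, i.e. lim_{n→∞} (1/n) ∑_{j=1}^{n} d_j(x) = 2. -/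
open MeasureTheory Filter Real Set

/-- Lebesgue measure on `(0, 1]`. -/
noncomputable def unitVolume : Measure ℝ := volume.restrict (Ioc (0:ℝ) 1)

instance : IsProbabilityMeasure unitVolume :=
  ⟨by simp [unitVolume]⟩

/-- The index `n` of the branch interval `(2^{-(n+1)}, 2^{-n}]` containing a point of `(0, 1]`. -/
noncomputable def branchIndex (x : ℝ) : ℕ := ⌊-Real.logb 2 x⌋.toNat

lemma measurable_floor_neg_logb : Measurable fun x : ℝ => ⌊-Real.logb 2 x⌋ :=
  Int.measurable_floor.comp (Real.measurable_log.div_const _).neg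

lemma measurable_branchIndex : Measurable branchIndex :=
  (measurable_of_countable Int.toNat).comp measurable_floor_neg_logb

lemma measurable_p2gleT : Measurable p2gleT :=
  (((measurable_of_countable fun n : ℤ => (2:ℝ) ^ (n + 1)).comp
    measurable_floor_neg_logb).mul measurable_id).sub_const 1

lemma floor_neg_logb_eq_branchIndex {x : ℝ} (hx : x ∈ Ioc (0:ℝ) 1) :
    ⌊-Real.logb 2 x⌋ = branchIndex x := by
  have h : Real.logb 2 x ≤ 0 := Real.logb_nonpos one_lt_two hx.1.le hx.2
  exact (Int.toNat_of_nonneg (Int.floor_nonneg.2 (by linarith))).symm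

lemma branchIndex_eq_iff {x : ℝ} (hx : x ∈ Ioc (0:ℝ) 1) (n : ℕ) :
    branchIndex x = n ↔ 1 < 2 ^ (n + 1) * x ∧ 2 ^ n * x ≤ 1 := by
  have key (m : ℕ) : -Real.logb 2 x < m ↔ 1 < 2 ^ m * x := by
    rw [neg_lt, Real.lt_logb_iff_rpow_lt one_lt_two hx.1, Real.rpow_neg two_pos.le,
      Real.rpow_natCast, inv_lt_iff_one_lt_mul₀ (by positivity), mul_comm]
  have h1 := key (n + 1)
  have h2 := not_congr (key n)
  rw [← Nat.cast_inj (R := ℤ), ← floor_neg_logb_eq_branchIndex hx, Int.floor_eq_iff]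
  push_cast at h1 ⊢
  rw [not_lt, not_lt] at h2
  rw [h1, h2, and_comm]

lemma p2gleT_eq {x : ℝ} (hx : x ∈ Ioc (0:ℝ) 1) :
    p2gleT x = 2 ^ (branchIndex x + 1) * x - 1 := by
  rw [p2gleT, floor_neg_logb_eq_branchIndex hx]
  norm_cast

/-- Inside a single branch, `p2gleT` is affine onto `(0, 1]`. -/
lemma unitVolume_branch_inter_preimage (n : ℕ) {B : Set ℝ} (hB : MeasurableSet B) :
    unitVolume (branchIndex ⁻¹' {n} ∩ p2gleT ⁻¹' B) =
      ENNReal.ofReal ((1 / 2) ^ (n + 1)) * unitVolume B := by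
  have h2 : (1:ℝ) ≤ 2 ^ n := one_le_pow₀ one_le_two
  have hset : (branchIndex ⁻¹' {n} ∩ p2gleT ⁻¹' B) ∩ Ioc (0:ℝ) 1 =
      (fun x => (2:ℝ) ^ (n + 1) * x) ⁻¹' ((fun y => y + (-1)) ⁻¹' (B ∩ Ioc (0:ℝ) 1)) := by
    ext x
    simp only [mem_inter_iff, mem_preimage, mem_singleton_iff]
    constructor
    · rintro ⟨⟨rfl, hxB⟩, hx⟩
      obtain ⟨h3, h4⟩ := (branchIndex_eq_iff hx _).1 rfl
      rw [p2gleT_eq hx] at hxB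
      refine ⟨hxB, by linarith, ?_⟩
      rw [pow_succ]
      linarith
    · rintro ⟨hxB, h3, h4⟩
      have hpos : 0 < x := pos_of_mul_pos_right (a := (2:ℝ) ^ (n + 1)) (by linarith) (by positivity)
      have h5 : 2 ^ n * x ≤ 1 := by
        rw [pow_succ] at h4
        linarith
      have hx : x ∈ Ioc (0:ℝ) 1 := ⟨hpos, by nlinarith⟩
      have hn : branchIndex x = n := (branchIndex_eq_iff hx n).2 ⟨by linarith, h5⟩
      refine ⟨⟨hn, ?_⟩, hx⟩
      rw [p2gleT_eq hx, hn]
      exact hxB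
  rw [unitVolume, Measure.restrict_apply
      ((measurable_branchIndex (measurableSet_singleton n)).inter (measurable_p2gleT hB)),
    Measure.restrict_apply hB, hset, Real.volume_preimage_mul_left (by positivity),
    measure_preimage_add_right, abs_of_pos (by positivity), one_div, inv_pow]

lemma unitVolume_branchIndex_inter_preimage (S : Set ℕ) {B : Set ℝ} (hB : MeasurableSet B) :
    unitVolume (branchIndex ⁻¹' S ∩ p2gleT ⁻¹' B) =
      unitVolume (branchIndex ⁻¹' S) * unitVolume B := by
  have key {B : Set ℝ} (hB : MeasurableSet B) :
      unitVolume (branchIndex ⁻¹' S ∩ p2gleT ⁻¹' B) =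
        (∑' n : S, ENNReal.ofReal ((1 / 2) ^ ((n : ℕ) + 1))) * unitVolume B := by
    have hmeas (s : Set ℕ) : MeasurableSet (branchIndex ⁻¹' s) :=
      measurable_branchIndex (MeasurableSet.of_discrete)
    rw [← Measure.restrict_apply (hmeas S),
      ← tsum_measure_preimage_singleton S.to_countable fun n _ => hmeas {n},
      ← ENNReal.tsum_mul_right]
    refine tsum_congr fun n => ?_
    rw [Measure.restrict_apply (hmeas _), unitVolume_branch_inter_preimage _ hB]
  have huniv := key MeasurableSet.univ
  rw [preimage_univ, inter_univ, measure_univ, mul_one] at huniv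
  rw [key hB, huniv]

lemma measurePreserving_p2gleT : MeasurePreserving p2gleT unitVolume unitVolume := by
  refine ⟨measurable_p2gleT, Measure.ext fun B hB => ?_⟩
  rw [Measure.map_apply measurable_p2gleT hB]
  simpa using unitVolume_branchIndex_inter_preimage univ hB

lemma measurePreserving_iterate_p2gleT (j : ℕ) :
    MeasurePreserving p2gleT^[j] unitVolume unitVolume :=
  measurePreserving_p2gleT.iterate j

lemma indepFun_branchIndex_p2gleT :
    ProbabilityTheory.IndepFun branchIndex p2gleT unitVolume := by
  rw [ProbabilityTheory.indepFun_iff_measure_inter_preimage_eq_mul]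
  intro S B _ hB
  rw [unitVolume_branchIndex_inter_preimage S hB,
    measurePreserving_p2gleT.measure_preimage hB.nullMeasurableSet]

lemma indepFun_branchIndex_iterate {i j : ℕ} (hij : i < j) :
    ProbabilityTheory.IndepFun (branchIndex ∘ p2gleT^[i]) (branchIndex ∘ p2gleT^[j])
      unitVolume := by
  obtain ⟨k, rfl⟩ := Nat.exists_eq_add_of_lt hij
  have hE := measurable_branchIndex
  have hT := measurePreserving_iterate_p2gleT i
  have h0 : ProbabilityTheory.IndepFun branchIndex ((branchIndex ∘ p2gleT^[k]) ∘ p2gleT)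
      unitVolume :=
    indepFun_branchIndex_p2gleT.comp (φ := id) measurable_id
      (hE.comp (measurePreserving_iterate_p2gleT k).measurable)
  rw [← hT.map_eq] at h0
  have hsplit : branchIndex ∘ p2gleT^[i + k + 1] =
      ((branchIndex ∘ p2gleT^[k]) ∘ p2gleT) ∘ p2gleT^[i] := by
    rw [Function.comp_assoc, Function.comp_assoc, ← Function.comp_assoc (p2gleT^[k]),
      ← Function.iterate_succ, ← Function.iterate_add, show i + k + 1 = k.succ + i by omega]
  rw [hsplit]
  rw [ProbabilityTheory.indepFun_iff_measure_inter_preimage_eq_mul] at h0 ⊢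
  have hF : Measurable ((branchIndex ∘ p2gleT^[k]) ∘ p2gleT) :=
    (hE.comp (measurePreserving_iterate_p2gleT k).measurable).comp measurable_p2gleT
  intro S U hS hU
  have := h0 S U hS hU
  rwa [Measure.map_apply hT.measurable ((hE hS).inter (hF hU)),
    Measure.map_apply hT.measurable (hE hS), Measure.map_apply hT.measurable (hF hU)] at this

lemma lintegral_branchIndex_add_one :
    ∫⁻ x, ENNReal.ofReal (branchIndex x + 1) ∂unitVolume = ENNReal.ofReal 2 := by
  have hmeas : Measurable fun n : ℕ => ENNReal.ofReal ((n : ℝ) + 1) := measurable_of_countable _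
  have hterm (n : ℕ) : ENNReal.ofReal ((n : ℝ) + 1) * (unitVolume.map branchIndex) {n} =
      ENNReal.ofReal (((n : ℝ) + 1) * (1 / 2) ^ (n + 1)) := by
    have h := unitVolume_branch_inter_preimage n MeasurableSet.univ
    rw [preimage_univ, inter_univ, measure_univ, mul_one] at h
    rw [Measure.map_apply measurable_branchIndex (measurableSet_singleton n), h,
      ENNReal.ofReal_mul (by positivity)]
  have hsum : HasSum (fun n : ℕ => ((n : ℝ) + 1) * (1 / 2) ^ (n + 1)) 2 := by
    have h := hasSum_coe_mul_geometric_of_norm_lt_one (r := (1 / 2 : ℝ)) (by norm_num)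
    rw [← hasSum_nat_add_iff' 1] at h
    norm_num at h ⊢
    exact h
  rw [← lintegral_map hmeas measurable_branchIndex, lintegral_countable']
  simp_rw [hterm]
  rw [← ENNReal.ofReal_tsum_of_nonneg (fun n => by positivity) hsum.summable, hsum.tsum_eq]

lemma measurable_branchIndex_add_one : Measurable fun x => (branchIndex x : ℝ) + 1 :=
  (measurable_of_countable fun n : ℕ => (n : ℝ) + 1).comp measurable_branchIndex

lemma integrable_branchIndex_add_one :
    Integrable (fun x => (branchIndex x : ℝ) + 1) unitVolume := by
  refine ⟨measurable_branchIndex_add_one.aestronglyMeasurable, ?_⟩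
  rw [hasFiniteIntegral_iff_ofReal (ae_of_all _ fun x => by positivity),
    lintegral_branchIndex_add_one]
  exact ENNReal.ofReal_lt_top

lemma integral_branchIndex_add_one :
    ∫ x, ((branchIndex x : ℝ) + 1) ∂unitVolume = 2 := by
  rw [integral_eq_lintegral_of_nonneg_ae (ae_of_all _ fun x => by positivity)
    measurable_branchIndex_add_one.aestronglyMeasurable, lintegral_branchIndex_add_one]
  simp

lemma ae_ceil_neg_logb_eq :
    ∀ᵐ x ∂unitVolume, ⌈-Real.logb 2 x⌉ = (branchIndex x : ℤ) + 1 := by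
  have hcount : (range fun k : ℤ => (2:ℝ) ^ (-(k : ℝ))).Countable := countable_range _
  have hnull : ∀ᵐ x ∂unitVolume, x ∉ range fun k : ℤ => (2:ℝ) ^ (-(k : ℝ)) :=
    ae_restrict_of_ae (hcount.ae_notMem _)
  have hmem : ∀ᵐ x ∂unitVolume, x ∈ Ioc (0:ℝ) 1 := ae_restrict_mem measurableSet_Ioc
  filter_upwards [hnull, hmem] with x hx h01
  rw [← floor_neg_logb_eq_branchIndex h01, Int.ceil_eq_floor_add_one_iff_notMem]
  rintro ⟨k, hk⟩
  refine hx ⟨k, ?_⟩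
  simp only [hk, neg_neg]
  exact Real.rpow_logb two_pos (by norm_num) h01.1

theorem khinchine_exponent_ae_two :
    ∀ᵐ x ∂(volume.restrict (Ioc (0:ℝ) 1)),
      Tendsto (fun n : ℕ => (∑ j ∈ Finset.range n, (p2gleD j x : ℝ)) / n) atTop (nhds 2) := by
  change ∀ᵐ x ∂unitVolume, _
  have hφ : Measurable fun n : ℕ => (n : ℝ) + 1 := measurable_of_countable _
  have hlaw := ProbabilityTheory.strong_law_ae_real (μ := unitVolume)
    (fun j x => (branchIndex (p2gleT^[j] x) : ℝ) + 1) integrable_branchIndex_add_one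
    (fun i j hij => by
      rcases hij.lt_or_gt with h | h
      · exact (indepFun_branchIndex_iterate h).comp hφ hφ
      · exact ((indepFun_branchIndex_iterate h).comp hφ hφ).symm)
    (fun j => by
      have hT := measurePreserving_iterate_p2gleT j
      refine ⟨(measurable_branchIndex_add_one.comp hT.measurable).aemeasurable,
        measurable_branchIndex_add_one.aemeasurable, ?_⟩
      change Measure.map ((fun x => (branchIndex x : ℝ) + 1) ∘ p2gleT^[j]) _ = _
      rw [← Measure.map_map measurable_branchIndex_add_one hT.measurable, hT.map_eq]
      rfl)
  simp only [Function.iterate_zero, id_eq, integral_branchIndex_add_one] at hlaw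
  have hdigit : ∀ᵐ x ∂unitVolume, ∀ j : ℕ,
      p2gleD j x = (branchIndex (p2gleT^[j] x) : ℤ) + 1 :=
    ae_all_iff.2 fun j =>
      (measurePreserving_iterate_p2gleT j).quasiMeasurePreserving.ae ae_ceil_neg_logb_eq
  filter_upwards [hlaw, hdigit] with x hx hd
  simpa [hd] using hx
end

section
/- Define t : (1,∞) → ℝ by t(ξ) = (log(ξ−1)/ξ + log ξ − log(ξ−1)) / log 2. For every ξ > 1 the second derivative is t″(ξ) = (2(ξ−1)log(ξ−1) − ξ) / (ξ³(ξ−1) log 2), and there exists a unique point ξ̃ > 1 with t″(ξ̃) = 0; moreover ξ̃ ∈ (3, 1+e), t″(ξ) < 0 for 1 < ξ < ξ̃, and t″(ξ) > 0 for ξ > ξ̃. In particular t has exactly one inflection point. -/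
open Filter Real Set

/-- The Khintchine spectrum of the P2GLE:
`t(ξ) = (log(ξ-1)/ξ + log ξ - log(ξ-1)) / log 2`. -/
noncomputable def tSpec (ξ : ℝ) : ℝ :=
  (Real.log (ξ - 1) / ξ + Real.log ξ - Real.log (ξ - 1)) / Real.log 2

theorem hasDerivAt_tSpec {ξ : ℝ} (h : 1 < ξ) :
    HasDerivAt tSpec (-Real.log (ξ - 1) / ξ ^ 2 / Real.log 2) ξ := by
  have h0 : ξ ≠ 0 := by linarith
  have h1 : ξ - 1 ≠ 0 := by linarith
  have hlog : HasDerivAt (fun x : ℝ => Real.log (x - 1)) (1 / (ξ - 1)) ξ :=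
    ((hasDerivAt_id ξ).sub_const 1).log h1
  have key := (((hlog.div (hasDerivAt_id ξ) h0).add (Real.hasDerivAt_log h0)).sub
    hlog).div_const (Real.log 2)
  refine key.congr_deriv ?_
  simp only [id_eq]
  congr 1
  field_simp
  ring

theorem deriv_deriv_tSpec {ξ : ℝ} (h : 1 < ξ) :
    deriv (deriv tSpec) ξ =
      (2 * (ξ - 1) * Real.log (ξ - 1) - ξ) / (ξ ^ 3 * (ξ - 1) * Real.log 2) := by
  have h0 : ξ ≠ 0 := by linarith
  have h1 : ξ - 1 ≠ 0 := by linarith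
  have h2 : Real.log 2 ≠ 0 := (Real.log_pos one_lt_two).ne'
  have heq : deriv tSpec =ᶠ[nhds ξ] fun x => -Real.log (x - 1) / x ^ 2 / Real.log 2 := by
    filter_upwards [lt_mem_nhds h] with x hx using (hasDerivAt_tSpec hx).deriv
  rw [heq.deriv_eq]
  have hlog : HasDerivAt (fun x : ℝ => Real.log (x - 1)) (1 / (ξ - 1)) ξ :=
    ((hasDerivAt_id ξ).sub_const 1).log h1
  have key := (hlog.neg.div (hasDerivAt_pow 2 ξ) (pow_ne_zero 2 h0)).div_const (Real.log 2)
  refine (key.congr_deriv ?_).deriv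
  simp only [Pi.neg_apply]
  field_simp
  ring

/-- The function `2 log (ξ - 1) - 1 - 1 / (ξ - 1)`, which has the sign of the second derivative
of `tSpec` on `(1, ∞)`. -/
noncomputable def tSpecSign (ξ : ℝ) : ℝ :=
  2 * Real.log (ξ - 1) - 1 - (ξ - 1)⁻¹

theorem deriv_deriv_tSpec_eq_mul {ξ : ℝ} (h : 1 < ξ) :
    deriv (deriv tSpec) ξ = tSpecSign ξ * (ξ ^ 3 * Real.log 2)⁻¹ := by
  have h0 : ξ ≠ 0 := by linarith
  have h1 : ξ - 1 ≠ 0 := by linarith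
  have h2 : Real.log 2 ≠ 0 := (Real.log_pos one_lt_two).ne'
  rw [deriv_deriv_tSpec h, tSpecSign]
  field_simp
  ring

theorem strictMonoOn_tSpecSign : StrictMonoOn tSpecSign (Ioi 1) := by
  intro x hx y hy hxy
  have hx' : 0 < x - 1 := sub_pos.2 hx
  have hxy' : x - 1 < y - 1 := by linarith
  have hlog := Real.log_lt_log hx' hxy'
  have hinv := inv_strictAnti₀ hx' hxy'
  unfold tSpecSign
  linarith

theorem exists_tSpecSign_eq_zero : ∃ ξ ∈ Ioo 3 (1 + Real.exp 1), tSpecSign ξ = 0 := by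
  have he := Real.exp_one_gt_d9
  have hcont : ContinuousOn tSpecSign (Icc 3 (1 + Real.exp 1)) := by
    have hne : ∀ x ∈ Icc 3 (1 + Real.exp 1), x - 1 ≠ 0 := fun x hx => by linarith [hx.1]
    have hsub : ContinuousOn (fun x : ℝ => x - 1) (Icc 3 (1 + Real.exp 1)) := by fun_prop
    exact ((continuousOn_const.mul (hsub.log hne)).sub continuousOn_const).sub (hsub.inv₀ hne)
  have hleft : tSpecSign 3 < 0 := by
    have := Real.log_two_lt_d9
    norm_num [tSpecSign]
    linarith
  have hright : 0 < tSpecSign (1 + Real.exp 1) := by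
    have : (Real.exp 1)⁻¹ < 1 := inv_lt_one_of_one_lt₀ (by linarith)
    simp only [tSpecSign, add_sub_cancel_left, Real.log_exp]
    linarith
  exact intermediate_value_Ioo (by linarith) hcont ⟨hleft, hright⟩

theorem tSpec_inflection :
    (∀ ξ : ℝ, 1 < ξ →
      deriv (deriv tSpec) ξ =
        (2 * (ξ - 1) * Real.log (ξ - 1) - ξ) / (ξ ^ 3 * (ξ - 1) * Real.log 2)) ∧
    ∃ ξt : ℝ, 1 < ξt ∧ 3 < ξt ∧ ξt < 1 + Real.exp 1 ∧
      deriv (deriv tSpec) ξt = 0 ∧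
      (∀ ξ : ℝ, 1 < ξ → ξ < ξt → deriv (deriv tSpec) ξ < 0) ∧
      (∀ ξ : ℝ, ξt < ξ → 0 < deriv (deriv tSpec) ξ) ∧
      (∀ ξ : ℝ, 1 < ξ → deriv (deriv tSpec) ξ = 0 → ξ = ξt) := by
  refine ⟨fun ξ h => deriv_deriv_tSpec h, ?_⟩
  obtain ⟨ξt, ⟨h3, he⟩, hzero⟩ := exists_tSpecSign_eq_zero
  have h1 : 1 < ξt := by linarith
  have hpos : ∀ ξ : ℝ, 1 < ξ → 0 < (ξ ^ 3 * Real.log 2)⁻¹ := fun ξ h =>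
    inv_pos.2 (mul_pos (pow_pos (by linarith) 3) (Real.log_pos one_lt_two))
  refine ⟨ξt, h1, h3, he, ?_, fun ξ h hlt => ?_, fun ξ hlt => ?_, fun ξ h hd => ?_⟩
  · rw [deriv_deriv_tSpec_eq_mul h1, hzero, zero_mul]
  · rw [deriv_deriv_tSpec_eq_mul h]
    exact mul_neg_of_neg_of_pos (hzero ▸ strictMonoOn_tSpecSign h h1 hlt) (hpos ξ h)
  · have h : 1 < ξ := h1.trans hlt
    rw [deriv_deriv_tSpec_eq_mul h]
    exact mul_pos (hzero ▸ strictMonoOn_tSpecSign h1 h hlt) (hpos ξ h)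
  · rw [deriv_deriv_tSpec_eq_mul h] at hd
    have hs : tSpecSign ξ = 0 := (mul_eq_zero.1 hd).resolve_right (hpos ξ h).ne'
    exact strictMonoOn_tSpecSign.injOn h h1 (hs.trans hzero.symm)
end

section
/- For every real number β > log 2, the Hausdorff dimension of the level set F(β) = {x ∈ (0,1] : lim_{n→∞} (1/n) ∑_{j=1}^{n} d_j(x)·log 2 = β} equals (1/β)·log(β/log 2 − 1) − (1/log 2)·log(1 − log 2/β). -/
open MeasureTheory Filter Real Set

/-- The level set `F(β)` of points whose Lyapunov exponent
`λ(x) = lim (1/n) ∑_{j=1}^n d_j(x)·log 2` equals `β`. -/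
noncomputable def lyapLevelSet (β : ℝ) : Set ℝ :=
  {x ∈ Ioc (0:ℝ) 1 |
    Tendsto (fun n : ℕ => (∑ j ∈ Finset.range n, (p2gleD j x : ℝ) * Real.log 2) / n)
      atTop (nhds β)}

open scoped Topology ENNReal NNReal

namespace P2GLE

/-- The exponent `⌊-log₂ (T^j x)⌋`, one less than the index of the branch containing `T^j x`. -/
noncomputable def branch (j : ℕ) (x : ℝ) : ℕ := ⌊-Real.logb 2 (p2gleT^[j] x)⌋₊

theorem neg_logb_nonneg {x : ℝ} (hx : x ∈ Ioc (0 : ℝ) 1) : 0 ≤ -Real.logb 2 x := by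
  have := Real.logb_nonpos (b := 2) (by norm_num) hx.1.le hx.2
  linarith

theorem p2gleT_eq {x : ℝ} (hx : x ∈ Ioc (0 : ℝ) 1) :
    p2gleT x = 2 ^ (⌊-Real.logb 2 x⌋₊ + 1) * x - 1 := by
  have h : (⌊-Real.logb 2 x⌋ : ℤ) = ((⌊-Real.logb 2 x⌋₊ : ℕ) : ℤ) :=
    (Int.natCast_floor_eq_floor (neg_logb_nonneg hx)).symm
  rw [p2gleT, h]
  norm_cast

theorem p2gleT_mem {x : ℝ} (hx : x ∈ Ioc (0 : ℝ) 1) : p2gleT x ∈ Ioc (0 : ℝ) 1 := by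
  rw [p2gleT_eq hx]
  have h0 := neg_logb_nonneg hx
  have h1 := Nat.floor_le h0
  have h2 := Nat.lt_floor_add_one (-Real.logb 2 x)
  set k := ⌊-Real.logb 2 x⌋₊
  have hx2 : x = 2 ^ (Real.logb 2 x) := (Real.rpow_logb (by norm_num) (by norm_num) hx.1).symm
  have h3 : (2 : ℝ) ^ (k + 1) * x = 2 ^ ((k : ℝ) + 1 + Real.logb 2 x) := by
    rw [Real.rpow_add (by norm_num), ← hx2]
    norm_cast
  rw [h3]
  constructor
  · have := Real.one_lt_rpow (x := 2) (by norm_num) (show 0 < (k : ℝ) + 1 + Real.logb 2 x by linarith)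
    linarith
  · have := Real.rpow_le_rpow_of_exponent_le (x := 2) (by norm_num)
      (show (k : ℝ) + 1 + Real.logb 2 x ≤ 1 by linarith)
    norm_num at this ⊢
    linarith

theorem iterate_mem {x : ℝ} (hx : x ∈ Ioc (0 : ℝ) 1) (n : ℕ) : p2gleT^[n] x ∈ Ioc (0 : ℝ) 1 := by
  induction n with
  | zero => exact hx
  | succ n ih => rw [Function.iterate_succ_apply']; exact p2gleT_mem ih

/-- `T^n` is affine of slope `2 ^ (d_1 + ⋯ + d_n)` on each cylinder. -/
theorem iterate_sub_iterate {x y : ℝ} (hx : x ∈ Ioc (0 : ℝ) 1) (hy : y ∈ Ioc (0 : ℝ) 1) (n : ℕ)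
    (h : ∀ i < n, branch i x = branch i y) :
    p2gleT^[n] x - p2gleT^[n] y = 2 ^ (∑ i ∈ Finset.range n, (branch i x + 1)) * (x - y) := by
  induction n with
  | zero => simp
  | succ n ih =>
    have hb := h n (Nat.lt_succ_self n)
    have ih' := ih fun i hi => h i (hi.trans (Nat.lt_succ_self n))
    rw [Function.iterate_succ_apply', Function.iterate_succ_apply', p2gleT_eq (iterate_mem hx n),
      p2gleT_eq (iterate_mem hy n), Finset.sum_range_succ]
    change 2 ^ (branch n x + 1) * _ - 1 - (2 ^ (branch n y + 1) * _ - 1) = _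
    rw [← hb, pow_add 2 (∑ i ∈ Finset.range n, (branch i x + 1))]
    linear_combination (2 ^ (branch n x + 1)) * ih'

theorem abs_sub_le_of_branch_eq {x y : ℝ} (hx : x ∈ Ioc (0 : ℝ) 1) (hy : y ∈ Ioc (0 : ℝ) 1)
    (n : ℕ) (h : ∀ i < n, branch i x = branch i y) :
    |x - y| ≤ ((2 : ℝ) ^ (∑ i ∈ Finset.range n, (branch i x + 1)))⁻¹ := by
  have h1 := iterate_sub_iterate hx hy n h
  have hx' := iterate_mem hx n
  have hy' := iterate_mem hy n
  have h2 : |p2gleT^[n] x - p2gleT^[n] y| ≤ 1 := by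
    rw [abs_le]
    constructor <;> linarith [hx'.1, hx'.2, hy'.1, hy'.2]
  rw [h1, abs_mul, abs_of_pos (by positivity)] at h2
  rw [← one_div, le_div_iff₀ (by positivity)]
  linarith

theorem p2gleT_one : p2gleT 1 = 1 := by
  simp [p2gleT]; norm_num

theorem p2gleD_eq_zero_of_iterate_eq_one {x : ℝ} {n : ℕ} (h : p2gleT^[n] x = 1) {j : ℕ}
    (hj : n ≤ j) : p2gleD j x = 0 := by
  obtain ⟨k, rfl⟩ := Nat.exists_eq_add_of_le' hj
  rw [p2gleD, Function.iterate_add_apply, h, Function.iterate_fixed p2gleT_one]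
  simp

/-- Unless `T^j x` is an endpoint of a branch, and so falls on the fixed point `1`, the digit is
one more than the branch exponent. -/
theorem p2gleD_eq {x : ℝ} (hx : x ∈ Ioc (0 : ℝ) 1) (j : ℕ) (h : p2gleT^[j + 1] x ≠ 1) :
    p2gleD j x = branch j x + 1 := by
  have hy := iterate_mem hx j
  rw [Function.iterate_succ_apply', p2gleT_eq hy] at h
  change 2 ^ (branch j x + 1) * _ - 1 ≠ (1 : ℝ) at h
  have h0 := neg_logb_nonneg hy
  have h1 : (branch j x : ℝ) ≤ _ := Nat.floor_le h0
  have h2 : _ < (branch j x : ℝ) + 1 := Nat.lt_floor_add_one (-Real.logb 2 (p2gleT^[j] x))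
  have hne : (branch j x : ℝ) ≠ -Real.logb 2 (p2gleT^[j] x) := by
    intro he
    apply h
    have h3 : p2gleT^[j] x = (2 ^ branch j x)⁻¹ := by
      rw [← Real.rpow_natCast, he, ← Real.rpow_neg (by norm_num), neg_neg,
        Real.rpow_logb (by norm_num) (by norm_num) hy.1]
    rw [h3, pow_succ]
    field_simp
    norm_num
  rw [p2gleD, Int.ceil_eq_iff]
  push_cast
  exact ⟨by linarith [lt_of_le_of_ne h1 hne], h2.le⟩

theorem tendsto_branch_of_mem {β : ℝ} (hβ : Real.log 2 < β) {x : ℝ} (hx : x ∈ lyapLevelSet β) :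
    Tendsto (fun n : ℕ => ((∑ j ∈ Finset.range n, (branch j x + 1) : ℕ) : ℝ) / n) atTop
      (𝓝 (β / Real.log 2)) := by
  have hL : 0 < Real.log 2 := Real.log_pos (by norm_num)
  obtain ⟨hx0, hx1⟩ := hx
  by_cases h : ∃ n, p2gleT^[n] x = 1
  · obtain ⟨n, hn⟩ := h
    have h0 : Tendsto (fun m : ℕ => (∑ j ∈ Finset.range m, (p2gleD j x : ℝ) * Real.log 2) / m)
        atTop (𝓝 0) := by
      refine Tendsto.congr' ?_ (tendsto_const_div_atTop_nhds_zero_nat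
        (∑ j ∈ Finset.range n, (p2gleD j x : ℝ) * Real.log 2))
      filter_upwards [eventually_ge_atTop n] with m hm
      congr 1
      refine Finset.sum_subset (Finset.range_mono hm) fun j _ hj => ?_
      rw [p2gleD_eq_zero_of_iterate_eq_one hn (by simpa using hj)]
      simp
    have := tendsto_nhds_unique h0 hx1
    linarith
  · push Not at h
    refine (hx1.div_const (Real.log 2)).congr fun n => ?_
    rw [← Finset.sum_mul, div_right_comm, mul_div_cancel_right₀ _ hL.ne']
    congr 1
    push_cast
    refine Finset.sum_congr rfl fun j _ => ?_
    rw [p2gleD_eq hx0 j (h _)]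
    push_cast
    ring

theorem sum_prod_geometric_le_one {p q : ℝ} (hp : 0 < p) (hq : 0 ≤ q) (hpq : p + q = 1)
    (n m : ℕ) : ∑ f : Fin n → Fin m, ∏ i, p * q ^ (f i : ℕ) ≤ 1 := by
  have hgeom : ∑ k : Fin m, p * q ^ (k : ℕ) ≤ 1 := by
    rw [Fin.sum_univ_eq_sum_range (fun k => p * q ^ k) m, ← Finset.mul_sum,
      show p = 1 - q by linarith, mul_neg_geom_sum]
    linarith [pow_nonneg hq m]
  have hprod := Fintype.prod_sum fun (_ : Fin n) (k : Fin m) => p * q ^ (k : ℕ)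
  rw [← hprod]
  exact Finset.prod_le_one (fun _ _ => Finset.sum_nonneg fun _ _ => by positivity) fun _ _ => hgeom

theorem hausdorffMeasure_cylinders_eq_zero {p q ρ t : ℝ} (hp : 0 < p) (hq : 0 ≤ q)
    (hpq : p + q = 1) (hρ0 : 0 ≤ ρ) (hρ1 : ρ < 1) (ht : 0 < t) (K M : ℕ) :
    Measure.hausdorffMeasure t {x : ℝ | x ∈ Ioc (0 : ℝ) 1 ∧ ∀ n ≥ M,
      ∑ i ∈ Finset.range n, branch i x ≤ K * n ∧
      (((2 : ℝ) ^ (∑ i ∈ Finset.range n, branch i x + n))⁻¹) ^ t ≤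
        p ^ n * q ^ (∑ i ∈ Finset.range n, branch i x) * ρ ^ n} = 0 := by
  let cyl : ∀ n : ℕ, (Fin n → Fin (K * n + 1)) → Set ℝ := fun n f =>
    {x | x ∈ Ioc (0 : ℝ) 1 ∧ (∀ i : Fin n, branch i x = f i) ∧
      (((2 : ℝ) ^ (∑ i, (f i : ℕ) + n))⁻¹) ^ t ≤ p ^ n * q ^ (∑ i, (f i : ℕ)) * ρ ^ n}
  have hdiam : ∀ n f, Metric.ediam (cyl n f) ≤
      ENNReal.ofReal (((2 : ℝ) ^ (∑ i, (f i : ℕ) + n))⁻¹) := by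
    intro n f
    refine Metric.ediam_le fun x hx y hy => ?_
    rw [edist_dist, Real.dist_eq]
    refine ENNReal.ofReal_le_ofReal ((abs_sub_le_of_branch_eq hx.1 hy.1 n fun i hi => ?_).trans_eq ?_)
    · rw [hx.2.1 ⟨i, hi⟩, hy.2.1 ⟨i, hi⟩]
    · rw [Finset.sum_add_distrib, ← Fin.sum_univ_eq_sum_range]
      simp [hx.2.1]
  have hpow : ∀ n f, Metric.ediam (cyl n f) ^ t ≤
      ENNReal.ofReal ((∏ i, p * q ^ (f i : ℕ)) * ρ ^ n) := by
    intro n f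
    rcases (cyl n f).eq_empty_or_nonempty with h | ⟨x, hx⟩
    · simp [h, ht]
    · refine (ENNReal.rpow_le_rpow (hdiam n f) ht.le).trans ?_
      rw [ENNReal.ofReal_rpow_of_nonneg (by positivity) ht.le]
      refine ENNReal.ofReal_le_ofReal (hx.2.2.trans_eq ?_)
      rw [Finset.prod_mul_distrib, Finset.prod_pow_eq_pow_sum]
      simp
  have hsum : ∀ n, ∑ f, Metric.ediam (cyl n f) ^ t ≤ ENNReal.ofReal (ρ ^ n) := by
    intro n
    refine (Finset.sum_le_sum fun f _ => hpow n f).trans ?_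
    rw [← ENNReal.ofReal_sum_of_nonneg fun f _ => by positivity, ← Finset.sum_mul]
    refine ENNReal.ofReal_le_ofReal ?_
    exact mul_le_of_le_one_left (by positivity) (sum_prod_geometric_le_one hp hq hpq _ _)
  have hlim : Tendsto (fun n : ℕ => ENNReal.ofReal (ρ ^ n)) atTop (𝓝 0) := by
    simpa using ENNReal.tendsto_ofReal (tendsto_pow_atTop_nhds_zero_of_lt_one hρ0 hρ1)
  have hr : Tendsto (fun n : ℕ => ENNReal.ofReal ((1 / 2 : ℝ) ^ n)) atTop (𝓝 0) := by
    simpa using ENNReal.tendsto_ofReal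
      (tendsto_pow_atTop_nhds_zero_of_lt_one (r := (1 / 2 : ℝ)) (by norm_num) (by norm_num))
  rw [← nonpos_iff_eq_zero]
  refine (Measure.hausdorffMeasure_le_liminf_sum t _ _ hr cyl ?_ ?_).trans ?_
  · refine Eventually.of_forall fun n f => (hdiam n f).trans (ENNReal.ofReal_le_ofReal ?_)
    rw [one_div, inv_pow]
    gcongr
    · norm_num
    · omega
  · filter_upwards [eventually_ge_atTop M] with n hn x hx
    obtain ⟨h1, h2⟩ := hx.2 n hn
    have hlt : ∀ i : Fin n, branch i x < K * n + 1 := fun i =>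
      Nat.lt_succ_of_le ((Finset.single_le_sum (f := fun j => branch j x) (fun _ _ => Nat.zero_le _)
        (Finset.mem_range.2 i.2)).trans h1)
    refine mem_iUnion.2 ⟨fun i => ⟨branch i x, hlt i⟩, hx.1, fun i => rfl, ?_⟩
    simpa [Fin.sum_univ_eq_sum_range (fun j => branch j x)] using h2
  · rw [← hlim.liminf_eq]
    exact liminf_le_liminf (Eventually.of_forall hsum)

theorem dimH_lyapLevelSet_le {β p q t : ℝ} (hβ : Real.log 2 < β) (hp : 0 < p) (hq : 0 < q)
    (hpq : p + q = 1) (hpβ : p * β = Real.log 2) (ht : 0 < t)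
    (hent : -(p * Real.log p + q * Real.log q) < t * Real.log 2) :
    dimH (lyapLevelSet β) ≤ ENNReal.ofReal t := by
  have hL : 0 < Real.log 2 := Real.log_pos (by norm_num)
  have hβp : β / Real.log 2 = 1 / p := by
    rw [← hpβ]
    have : β ≠ 0 := by linarith
    field_simp
  obtain ⟨c, hc0, hc⟩ : ∃ c, 0 < c ∧
      c < t * Real.log 2 / p + Real.log p + (1 / p - 1) * Real.log q := by
    refine exists_between ?_
    have : t * Real.log 2 / p + Real.log p + (1 / p - 1) * Real.log q =
        (t * Real.log 2 + (p * Real.log p + q * Real.log q)) / p := by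
      rw [show q = 1 - p by linarith]
      field_simp
      ring
    rw [this]
    exact div_pos (by linarith) hp
  obtain ⟨K, hK⟩ := exists_nat_gt (1 / p)
  have hsub : lyapLevelSet β ⊆ ⋃ M : ℕ, {x : ℝ | x ∈ Ioc (0 : ℝ) 1 ∧ ∀ n ≥ M,
      ∑ i ∈ Finset.range n, branch i x ≤ K * n ∧
      (((2 : ℝ) ^ (∑ i ∈ Finset.range n, branch i x + n))⁻¹) ^ t ≤
        p ^ n * q ^ (∑ i ∈ Finset.range n, branch i x) * (Real.exp (-c)) ^ n} := by
    intro x hx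
    have hlim := tendsto_branch_of_mem hβ hx
    rw [hβp] at hlim
    have hlim2 := ((hlim.const_mul (t * Real.log 2)).add_const (Real.log p)).add
      ((hlim.sub_const 1).mul_const (Real.log q))
    have hc' : c < t * Real.log 2 * (1 / p) + Real.log p + (1 / p - 1) * Real.log q := by
      rw [mul_one_div]; exact hc
    obtain ⟨M, hM⟩ := eventually_atTop.1 ((hlim.eventually_lt_const hK).and
      ((hlim2.eventually_const_lt hc').and (eventually_gt_atTop 0)))
    refine mem_iUnion.2 ⟨M, hx.1, fun n hn => ?_⟩
    obtain ⟨h1, h2, h3⟩ := hM n hn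
    have hn0 : (0 : ℝ) < n := by exact_mod_cast h3
    rw [Finset.sum_add_distrib] at h1 h2
    simp only [Finset.sum_const, Finset.card_range, smul_eq_mul, mul_one] at h1 h2
    set B := ∑ i ∈ Finset.range n, branch i x
    constructor
    · rw [div_lt_iff₀ hn0] at h1
      have : B + n < K * n := by exact_mod_cast h1
      omega
    · have e1 : (((2 : ℝ) ^ (B + n))⁻¹) ^ t = Real.exp (-((B + n : ℕ) * (t * Real.log 2))) := by
        rw [Real.rpow_def_of_pos (by positivity), Real.log_inv, Real.log_pow]
        congr 1
        ring
      have e2 : p ^ n * q ^ B * (Real.exp (-c)) ^ n =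
          Real.exp (n * Real.log p + B * Real.log q - n * c) := by
        rw [sub_eq_add_neg, Real.exp_add, Real.exp_add, ← Real.log_pow, ← Real.log_pow,
          Real.exp_log (by positivity), Real.exp_log (by positivity), ← Real.exp_nat_mul]
        congr 2
        ring
      rw [e1, e2, Real.exp_le_exp]
      have h4 : t * Real.log 2 * (((B + n : ℕ) : ℝ) / n) + Real.log p +
          (((B + n : ℕ) : ℝ) / n - 1) * Real.log q =
          (t * Real.log 2 * (B + n : ℕ) + n * Real.log p + B * Real.log q) / n := by
        push_cast
        field_simp
        ring
      rw [h4, lt_div_iff₀ hn0] at h2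
      linarith
  lift t to ℝ≥0 using ht.le
  rw [ENNReal.ofReal_coe_nnreal]
  refine dimH_le_of_hausdorffMeasure_ne_top ?_
  rw [measure_mono_null hsub (measure_iUnion_null fun M => hausdorffMeasure_cylinders_eq_zero hp
    hq.le hpq (Real.exp_nonneg _) (Real.exp_lt_one_iff.2 (by linarith)) ht K M)]
  exact ENNReal.zero_ne_top

theorem ofDigits_eq_head_add_tail (ω : ℕ → Fin 2) :
    Real.ofDigits ω = (((ω 0 : ℕ) : ℝ) + Real.ofDigits fun i => ω (i + 1)) / 2 := by
  rw [Real.ofDigits_eq_sum_add_ofDigits ω 1]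
  simp [Real.ofDigitsTerm]
  ring

theorem ofDigits_eq_of_first_one {ω : ℕ → Fin 2} {D : ℕ} (h0 : ∀ i < D, ω i = 0) (h1 : ω D = 1) :
    Real.ofDigits ω = ((2 : ℝ) ^ (D + 1))⁻¹ * (1 + Real.ofDigits fun i => ω (i + (D + 1))) := by
  rw [Real.ofDigits_eq_sum_add_ofDigits ω (D + 1), Finset.sum_range_succ, Finset.sum_eq_zero]
  · simp [Real.ofDigitsTerm, h1]
    ring
  · intro i hi
    simp [Real.ofDigitsTerm, h0 i (Finset.mem_range.1 hi)]

theorem ofDigits_pos {ω : ℕ → Fin 2} (h : ∃ n, ω n = 1) : 0 < Real.ofDigits ω := by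
  obtain ⟨n, hn⟩ := h
  induction n generalizing ω with
  | zero =>
    rw [ofDigits_eq_head_add_tail, hn]
    have := Real.ofDigits_nonneg fun i => ω (i + 1)
    norm_num
    linarith
  | succ n ih =>
    rw [ofDigits_eq_head_add_tail]
    have := ih (ω := fun i => ω (i + 1)) hn
    positivity

theorem ofDigits_lt_one {ω : ℕ → Fin 2} (h : ∃ n, ω n = 0) : Real.ofDigits ω < 1 := by
  obtain ⟨n, hn⟩ := h
  induction n generalizing ω with
  | zero =>
    rw [ofDigits_eq_head_add_tail, hn]
    have := Real.ofDigits_le_one fun i => ω (i + 1)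
    norm_num
    linarith
  | succ n ih =>
    rw [ofDigits_eq_head_add_tail]
    have h1 := ih (ω := fun i => ω (i + 1)) hn
    have h2 : ((ω 0 : ℕ) : ℝ) ≤ 1 := by exact_mod_cast Nat.lt_succ_iff.1 (ω 0).2
    linarith

theorem p2gle_of_ofDigits {ω : ℕ → Fin 2} (hω1 : ∀ N, ∃ n, ω (n + N) = 1)
    (hω0 : ∀ N, ∃ n, ω (n + N) = 0) :
    ∃ S : ℕ, p2gleT (Real.ofDigits ω) = Real.ofDigits (fun i => ω (i + S)) ∧
      ⌈-Real.logb 2 (Real.ofDigits ω)⌉ = S ∧ ∑ i ∈ Finset.range S, (ω i : ℕ) = 1 := by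
  have hex : ∃ n, ω n = 1 := hω1 0
  have hlt : ∀ i < Nat.find hex, ω i = 0 := fun i hi => by
    have := Nat.find_min hex hi
    omega
  have h1 := Nat.find_spec hex
  set D := Nat.find hex
  set y := Real.ofDigits fun i => ω (i + (D + 1)) with hy
  have hy0 : 0 < y := ofDigits_pos (hω1 (D + 1))
  have hy1 : y < 1 := ofDigits_lt_one (hω0 (D + 1))
  have hφ : Real.ofDigits ω = ((2 : ℝ) ^ (D + 1))⁻¹ * (1 + y) := ofDigits_eq_of_first_one hlt h1
  have hlog : -Real.logb 2 (Real.ofDigits ω) = (D + 1) - Real.logb 2 (1 + y) := by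
    rw [hφ, Real.logb_mul (by positivity) (by positivity), Real.logb_inv, Real.logb_pow,
      Real.logb_self_eq_one (by norm_num)]
    push_cast
    ring
  have hl0 : 0 < Real.logb 2 (1 + y) := Real.logb_pos (by norm_num) (by linarith)
  have hl1 : Real.logb 2 (1 + y) < 1 := by
    rw [Real.logb_lt_iff_lt_rpow (by norm_num) (by linarith)]
    norm_num
    linarith
  refine ⟨D + 1, ?_, ?_, ?_⟩
  · have hfl : ⌊-Real.logb 2 (Real.ofDigits ω)⌋ = (D : ℤ) := by
      rw [hlog, Int.floor_eq_iff]
      push_cast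
      constructor <;> linarith
    rw [p2gleT, hfl, hφ]
    have : (2 : ℝ) ^ ((D : ℤ) + 1) = 2 ^ (D + 1) := by norm_cast
    rw [this, mul_inv_cancel_left₀ (by positivity)]
    simp [hy]
  · rw [hlog, Int.ceil_eq_iff]
    push_cast
    constructor <;> linarith
  · rw [Finset.sum_range_succ, Finset.sum_eq_zero fun i hi => ?_, h1]
    · rfl
    · simp [hlt i (Finset.mem_range.1 hi)]

theorem iterate_ofDigits {ω : ℕ → Fin 2} (hω1 : ∀ N, ∃ n, ω (n + N) = 1)
    (hω0 : ∀ N, ∃ n, ω (n + N) = 0) (n : ℕ) :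
    ∃ S : ℕ, p2gleT^[n] (Real.ofDigits ω) = Real.ofDigits (fun i => ω (i + S)) ∧
      ∑ j ∈ Finset.range n, p2gleD j (Real.ofDigits ω) = S ∧
      ∑ i ∈ Finset.range S, (ω i : ℕ) = n := by
  induction n with
  | zero => exact ⟨0, by simp⟩
  | succ n ih =>
    obtain ⟨S, h1, h2, h3⟩ := ih
    obtain ⟨S', h1', h2', h3'⟩ := p2gle_of_ofDigits (ω := fun i => ω (i + S))
      (fun N => by simpa only [add_assoc] using hω1 (N + S))
      (fun N => by simpa only [add_assoc] using hω0 (N + S))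
    refine ⟨S' + S, ?_, ?_, ?_⟩
    · rw [Function.iterate_succ_apply', h1, h1']
      simp only [add_assoc]
    · rw [Finset.sum_range_succ, h2, p2gleD, h1, h2']
      push_cast
      ring
    · rw [add_comm S' S, Finset.sum_range_add, h3]
      simp only [add_comm S]
      rw [h3']

theorem exists_ne_zero_of_tendsto_average {a : ℕ → ℝ} {c : ℝ} (hc : c ≠ 0)
    (h : Tendsto (fun n : ℕ => (∑ i ∈ Finset.range n, a i) / n) atTop (𝓝 c)) (N : ℕ) :
    ∃ n, a (n + N) ≠ 0 := by
  by_contra! hN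
  refine hc (tendsto_nhds_unique h (Tendsto.congr' ?_
    (tendsto_const_div_atTop_nhds_zero_nat (∑ j ∈ Finset.range N, a j))))
  filter_upwards [eventually_ge_atTop N] with m hm
  congr 1
  refine Finset.sum_subset (Finset.range_mono hm) fun j _ hj => ?_
  obtain ⟨k, rfl⟩ := Nat.exists_eq_add_of_le' (not_lt.1 (by simpa using hj) : N ≤ j)
  exact hN k

theorem ofDigits_mem_lyapLevelSet {β p : ℝ} (hp0 : 0 < p) (hp1 : p < 1)
    (hpβ : p * β = Real.log 2) {ω : ℕ → Fin 2}
    (h : Tendsto (fun n : ℕ => (∑ i ∈ Finset.range n, ((ω i : ℕ) : ℝ)) / n) atTop (𝓝 p)) :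
    Real.ofDigits ω ∈ lyapLevelSet β := by
  have hω1 : ∀ N, ∃ n, ω (n + N) = 1 := fun N => by
    obtain ⟨n, hn⟩ := exists_ne_zero_of_tendsto_average hp0.ne' h N
    refine ⟨n, ?_⟩
    have : (ω (n + N) : ℕ) ≠ 0 := by exact_mod_cast hn
    omega
  have h' : Tendsto (fun n : ℕ => (∑ i ∈ Finset.range n, (1 - ((ω i : ℕ) : ℝ))) / n) atTop
      (𝓝 (1 - p)) := by
    refine (h.const_sub 1).congr' ?_
    filter_upwards [eventually_gt_atTop 0] with n hn
    have : (n : ℝ) ≠ 0 := by positivity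
    rw [Finset.sum_sub_distrib]
    simp
    field_simp
  have hω0 : ∀ N, ∃ n, ω (n + N) = 0 := fun N => by
    obtain ⟨n, hn⟩ := exists_ne_zero_of_tendsto_average (by linarith) h' N
    refine ⟨n, ?_⟩
    by_contra hne
    have : (ω (n + N) : ℕ) = 1 := by omega
    simp [this] at hn
  refine ⟨⟨ofDigits_pos (hω1 0), (ofDigits_lt_one (hω0 0)).le⟩, ?_⟩
  choose S _ hS hcount using iterate_ofDigits hω1 hω0
  have hSn : ∀ n, n ≤ S n := fun n => by
    calc n = ∑ i ∈ Finset.range (S n), (ω i : ℕ) := (hcount n).symm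
      _ ≤ ∑ i ∈ Finset.range (S n), 1 := Finset.sum_le_sum fun i _ => Nat.lt_succ_iff.1 (ω i).2
      _ = S n := by simp
  have hlim := ((h.comp (tendsto_atTop_mono hSn tendsto_id)).inv₀ hp0.ne').mul_const (Real.log 2)
  rw [← hpβ, inv_mul_cancel_left₀ hp0.ne'] at hlim
  refine hlim.congr fun n => ?_
  have e1 : (∑ i ∈ Finset.range (S n), ((ω i : ℕ) : ℝ)) = n := by exact_mod_cast hcount n
  have e2 : (∑ j ∈ Finset.range n, (p2gleD j (Real.ofDigits ω) : ℝ)) = S n := by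
    exact_mod_cast hS n
  rw [← Finset.sum_mul, e2, Function.comp_apply, e1, hpβ, inv_div]
  ring

/-- Mass distribution principle, tested on dyadic scales. -/
theorem le_dimH_of_measure_le_dyadic {X : Type*} [MetricSpace X] [MeasurableSpace X] [BorelSpace X]
    {ν : Measure X} {A : Set X} {t C : ℝ} (ht : 0 < t) (hC : 0 < C) (M : ℕ) (hA : ν A ≠ 0)
    (h : ∀ N ≥ M, ∀ U : Set X, Metric.ediam U ≤ ENNReal.ofReal ((1 / 2 : ℝ) ^ N) →
      ν U ≤ ENNReal.ofReal (C * ((1 / 2 : ℝ) ^ N) ^ t)) :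
    ENNReal.ofReal t ≤ dimH A := by
  have hle : ENNReal.ofReal (C * 2 ^ t)⁻¹ • ν ≤ Measure.hausdorffMeasure t := by
    refine Measure.le_hausdorffMeasure t _ (ENNReal.ofReal ((1 / 2 : ℝ) ^ M))
      (ENNReal.ofReal_pos.2 (by positivity)) fun U hU => ?_
    rw [Measure.smul_apply, smul_eq_mul]
    have hfin : Metric.ediam U ≠ ∞ := ne_top_of_le_ne_top ENNReal.ofReal_ne_top hU
    obtain ⟨d, hd0, hd⟩ : ∃ d : ℝ, 0 ≤ d ∧ Metric.ediam U = ENNReal.ofReal d :=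
      ⟨_, ENNReal.toReal_nonneg, (ENNReal.ofReal_toReal hfin).symm⟩
    rw [hd] at hU ⊢
    have hdM : d ≤ (1 / 2 : ℝ) ^ M := (ENNReal.ofReal_le_ofReal_iff (by positivity)).1 hU
    rcases hd0.eq_or_lt with rfl | hdpos
    · have hzero : ν U ≤ 0 := by
        have hlim : Tendsto (fun N : ℕ => ENNReal.ofReal (C * ((1 / 2 : ℝ) ^ N) ^ t)) atTop
            (𝓝 0) := by
          have h1 : Tendsto (fun N : ℕ => C * ((1 / 2 : ℝ) ^ N) ^ t) atTop (𝓝 (C * 0 ^ t)) :=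
            ((tendsto_pow_atTop_nhds_zero_of_lt_one (by norm_num) (by norm_num)).rpow_const
              (Or.inr ht.le)).const_mul C
          rw [Real.zero_rpow ht.ne', mul_zero] at h1
          simpa using ENNReal.tendsto_ofReal h1
        refine ge_of_tendsto hlim ?_
        filter_upwards [eventually_ge_atTop M] with N hN
        exact h N hN U (by rw [hd]; exact ENNReal.ofReal_le_ofReal (by positivity))
      rw [nonpos_iff_eq_zero.1 hzero]
      simp
    · obtain ⟨N, hN1, hN2⟩ := exists_nat_pow_near_of_lt_one hdpos
        (hdM.trans (pow_le_one₀ (by norm_num) (by norm_num))) (y := (1 / 2 : ℝ)) (by norm_num)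
        (by norm_num)
      have hNM : M ≤ N := by
        by_contra! hlt
        have := pow_le_pow_of_le_one (a := (1 / 2 : ℝ)) (by norm_num) (by norm_num)
          (Nat.succ_le_of_lt hlt)
        exact absurd (hN1.trans_le hdM) (not_lt.2 this)
      rw [ENNReal.ofReal_rpow_of_nonneg hd0 ht.le]
      refine (mul_le_mul_right (h N hNM U (by rw [hd]; exact ENNReal.ofReal_le_ofReal hN2)) _).trans ?_
      rw [← ENNReal.ofReal_mul (by positivity)]
      refine ENNReal.ofReal_le_ofReal ?_
      have e : ((1 / 2 : ℝ) ^ N) ^ t = 2 ^ t * ((1 / 2 : ℝ) ^ (N + 1)) ^ t := by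
        rw [← Real.mul_rpow (by norm_num) (by positivity)]
        congr 1
        ring
      rw [e, ← mul_assoc C, inv_mul_cancel_left₀ (by positivity)]
      exact Real.rpow_le_rpow (by positivity) hN1.le ht.le
  have hpos : Measure.hausdorffMeasure t A ≠ 0 := by
    intro h0
    have := hle A
    rw [h0, Measure.smul_apply, smul_eq_mul, nonpos_iff_eq_zero, mul_eq_zero] at this
    rcases this with h1 | h1
    · rw [ENNReal.ofReal_eq_zero] at h1
      have : 0 < (C * 2 ^ t)⁻¹ := by positivity
      linarith
    · exact hA h1
  lift t to ℝ≥0 using ht.le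
  rw [ENNReal.ofReal_coe_nnreal]
  exact le_dimH_of_hausdorffMeasure_ne_zero hpos

/-- The integer whose binary digits are the first `N` digits of `ω`. -/
def initialNat (ω : ℕ → Fin 2) : ℕ → ℕ
  | 0 => 0
  | N + 1 => 2 * initialNat ω N + ω N

theorem ofDigits_mul_two_pow (ω : ℕ → Fin 2) (N : ℕ) :
    Real.ofDigits ω * 2 ^ N = initialNat ω N + Real.ofDigits fun i => ω (i + N) := by
  induction N with
  | zero => simp [initialNat]
  | succ N ih =>
    rw [pow_succ, ← mul_assoc, ih, ofDigits_eq_head_add_tail]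
    simp only [zero_add, initialNat, add_right_comm _ 1 N]
    push_cast
    simp only [add_assoc]
    ring

theorem eq_of_initialNat_eq {ω ω' : ℕ → Fin 2} {N : ℕ} (h : initialNat ω N = initialNat ω' N) :
    ∀ i < N, ω i = ω' i := by
  induction N with
  | zero => simp
  | succ N ih =>
    simp only [initialNat] at h
    have h1 := (ω N).2
    have h2 := (ω' N).2
    intro i hi
    rcases Nat.lt_succ_iff_lt_or_eq.1 hi with hi | rfl
    · exact ih (by omega) i hi
    · omega

theorem initialNat_le_add_two {ω ω' : ℕ → Fin 2} {N : ℕ}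
    (h : |Real.ofDigits ω - Real.ofDigits ω'| ≤ (1 / 2 : ℝ) ^ N) :
    initialNat ω N ≤ initialNat ω' N + 2 := by
  have h1 := ofDigits_mul_two_pow ω N
  have h2 := ofDigits_mul_two_pow ω' N
  have h3 := Real.ofDigits_nonneg fun i => ω (i + N)
  have h4 := Real.ofDigits_le_one fun i => ω' (i + N)
  have h5 : (Real.ofDigits ω - Real.ofDigits ω') * 2 ^ N ≤ 1 := by
    have := mul_le_mul_of_nonneg_right ((le_abs_self _).trans h) (pow_nonneg zero_le_two N)
    rwa [← mul_pow, show (1 / 2 : ℝ) * 2 = 1 by norm_num, one_pow] at this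
  have : (initialNat ω N : ℝ) ≤ initialNat ω' N + 2 := by linarith
  exact_mod_cast this

/-- A set of binary sequences mapped to a set of diameter at most `2⁻ᴺ` meets at most five
cylinders of length `N`. -/
theorem measure_le_of_abs_ofDigits_sub_le {P : Measure (ℕ → Fin 2)} {E : Set (ℕ → Fin 2)} {N : ℕ}
    {b : ℝ≥0∞} (hE : ∀ ω ∈ E, ∀ ω' ∈ E, |Real.ofDigits ω - Real.ofDigits ω'| ≤ (1 / 2 : ℝ) ^ N)
    (hcyl : ∀ ω ∈ E, P {ω' | ∀ i < N, ω' i = ω i} ≤ b) : P E ≤ 5 * b := by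
  rcases E.eq_empty_or_nonempty with rfl | ⟨ω₀, hω₀⟩
  · simp
  let s := Finset.Icc (initialNat ω₀ N - 2) (initialNat ω₀ N + 2)
  have hcover : E ⊆ ⋃ j ∈ s, {ω | ω ∈ E ∧ initialNat ω N = j} := by
    intro ω hω
    have h1 := initialNat_le_add_two (hE ω hω ω₀ hω₀)
    have h2 := initialNat_le_add_two (hE ω₀ hω₀ ω hω)
    refine mem_iUnion₂.2 ⟨initialNat ω N, Finset.mem_Icc.2 ⟨by omega, by omega⟩, hω, rfl⟩
  have hpiece : ∀ j ∈ s, P {ω | ω ∈ E ∧ initialNat ω N = j} ≤ b := by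
    intro j _
    rcases {ω | ω ∈ E ∧ initialNat ω N = j}.eq_empty_or_nonempty with h | ⟨ω₁, hω₁, hj⟩
    · simp [h]
    · refine (measure_mono fun ω hω => ?_).trans (hcyl ω₁ hω₁)
      exact eq_of_initialNat_eq (hω.2.trans hj.symm)
  calc P E ≤ P (⋃ j ∈ s, {ω | ω ∈ E ∧ initialNat ω N = j}) := measure_mono hcover
    _ ≤ ∑ j ∈ s, P {ω | ω ∈ E ∧ initialNat ω N = j} := measure_biUnion_finset_le _ _
    _ ≤ s.card • b := Finset.sum_le_card_nsmul _ _ _ hpiece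
    _ ≤ 5 * b := by
      rw [nsmul_eq_mul]
      gcongr
      have : s.card ≤ 5 := by simp only [s, Nat.card_Icc]; omega
      exact_mod_cast this

/-- The Bernoulli measure on one binary digit, giving mass `p` to `1` and `q` to `0`. -/
noncomputable def bern (p q : ℝ) : Measure (Fin 2) :=
  ENNReal.ofReal p • Measure.dirac 1 + ENNReal.ofReal q • Measure.dirac 0

theorem isProbabilityMeasure_bern {p q : ℝ} (hp : 0 ≤ p) (hq : 0 ≤ q) (hpq : p + q = 1) :
    IsProbabilityMeasure (bern p q) := by
  constructor
  simp [bern, ← ENNReal.ofReal_add hp hq, hpq]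

theorem bern_singleton {p q : ℝ} (hp : 0 < p) (hq : 0 < q) (a : Fin 2) :
    bern p q {a} =
      ENNReal.ofReal (Real.exp ((a : ℕ) * Real.log p + (1 - (a : ℕ)) * Real.log q)) := by
  fin_cases a <;> simp [bern, Real.exp_log hp, Real.exp_log hq]

theorem infinitePi_bern_cylinder {p q : ℝ} [IsProbabilityMeasure (bern p q)] (hp : 0 < p)
    (hq : 0 < q) (ω : ℕ → Fin 2) (N : ℕ) :
    Measure.infinitePi (fun _ : ℕ => bern p q) {ω' | ∀ i < N, ω' i = ω i} =
      ENNReal.ofReal (Real.exp (∑ i ∈ Finset.range N,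
        ((ω i : ℕ) * Real.log p + (1 - (ω i : ℕ)) * Real.log q))) := by
  have : {ω' : ℕ → Fin 2 | ∀ i < N, ω' i = ω i} =
      Set.pi (Finset.range N : Set ℕ) fun i => {ω i} := by
    ext; simp
  rw [this, Measure.infinitePi_pi _ fun i _ => measurableSet_singleton _, Real.exp_sum,
    ENNReal.ofReal_prod_of_nonneg fun i _ => (Real.exp_nonneg _)]
  exact Finset.prod_congr rfl fun i _ => bern_singleton hp hq _

theorem ae_tendsto_average_bern {p q : ℝ} [IsProbabilityMeasure (bern p q)] (hp : 0 < p) :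
    ∀ᵐ ω ∂Measure.infinitePi (fun _ : ℕ => bern p q),
      Tendsto (fun n : ℕ => (∑ i ∈ Finset.range n, ((ω i : ℕ) : ℝ)) / n) atTop (𝓝 p) := by
  set P := Measure.infinitePi (fun _ : ℕ => bern p q)
  have hmeas : Measurable fun a : Fin 2 => ((a : ℕ) : ℝ) := measurable_of_countable _
  have hX : ∀ i, Measurable fun ω : ℕ → Fin 2 => ((ω i : ℕ) : ℝ) := fun i =>
    hmeas.comp (measurable_pi_apply i)
  have hmap : ∀ i, P.map (fun ω : ℕ → Fin 2 => ((ω i : ℕ) : ℝ)) =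
      (bern p q).map fun a : Fin 2 => ((a : ℕ) : ℝ) := fun i => by
    rw [← Measure.infinitePi_map_eval (fun _ : ℕ => bern p q) i,
      Measure.map_map hmeas (measurable_pi_apply i)]
    rfl
  have hind := ProbabilityTheory.iIndepFun_infinitePi (P := fun _ : ℕ => bern p q)
    (X := fun _ (a : Fin 2) => ((a : ℕ) : ℝ)) fun _ => hmeas
  have hmean : ∫ ω, ((ω 0 : ℕ) : ℝ) ∂P = p := by
    have h1 : ∫ ω, ((ω 0 : ℕ) : ℝ) ∂P = ∫ a, ((a : ℕ) : ℝ) ∂(bern p q) := by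
      rw [← integral_map (φ := fun ω : ℕ → Fin 2 => ((ω 0 : ℕ) : ℝ)) (f := fun x => x)
        (hX 0).aemeasurable (by fun_prop), hmap,
        integral_map hmeas.aemeasurable (by fun_prop)]
    rw [h1, bern, integral_add_measure
      ((integrable_dirac (by simp)).smul_measure ENNReal.ofReal_ne_top)
      ((integrable_dirac (by simp)).smul_measure ENNReal.ofReal_ne_top)]
    simp [hp.le]
  have := ProbabilityTheory.strong_law_ae_real (μ := P)
    (fun i (ω : ℕ → Fin 2) => ((ω i : ℕ) : ℝ)) ?_ (fun i j hij => hind.indepFun hij)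
    (fun i => ⟨(hX i).aemeasurable, (hX 0).aemeasurable, by rw [hmap, hmap]⟩)
  · rwa [hmean] at this
  · refine Integrable.of_bound (hX 0).aestronglyMeasurable 1 (Eventually.of_forall fun ω => ?_)
    have : ((ω 0 : ℕ) : ℝ) ≤ 1 := by exact_mod_cast Nat.lt_succ_iff.1 (ω 0).2
    simpa using this

theorem le_dimH_lyapLevelSet {β p q t : ℝ} (hp : 0 < p) (hq : 0 < q) (hpq : p + q = 1)
    (hpβ : p * β = Real.log 2) (ht : 0 < t)
    (hent : t * Real.log 2 < -(p * Real.log p + q * Real.log q)) :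
    ENNReal.ofReal t ≤ dimH (lyapLevelSet β) := by
  have := isProbabilityMeasure_bern hp.le hq.le hpq
  set P := Measure.infinitePi (fun _ : ℕ => bern p q) with hP
  let A : ℕ → Set (ℕ → Fin 2) := fun M =>
    {ω | Tendsto (fun n : ℕ => (∑ i ∈ Finset.range n, ((ω i : ℕ) : ℝ)) / n) atTop (𝓝 p) ∧
      ∀ N ≥ M, P {ω' | ∀ i < N, ω' i = ω i} ≤ ENNReal.ofReal (((1 / 2 : ℝ) ^ N) ^ t)}
  have hA : ∀ᵐ ω ∂P, ω ∈ ⋃ M, A M := by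
    filter_upwards [ae_tendsto_average_bern (p := p) (q := q) hp] with ω hω
    have hlim : Tendsto (fun n : ℕ => (∑ i ∈ Finset.range n,
        ((ω i : ℕ) * Real.log p + (1 - (ω i : ℕ)) * Real.log q)) / n) atTop
        (𝓝 (p * Real.log p + (1 - p) * Real.log q)) := by
      refine ((hω.mul_const _).add ((hω.const_sub 1).mul_const _)).congr' ?_
      filter_upwards [eventually_gt_atTop 0] with n hn
      have : (n : ℝ) ≠ 0 := by positivity
      rw [Finset.sum_add_distrib, ← Finset.sum_mul, ← Finset.sum_mul, Finset.sum_sub_distrib]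
      simp
      field_simp
    have hlt : p * Real.log p + (1 - p) * Real.log q < -(t * Real.log 2) := by
      rw [show 1 - p = q by linarith]
      linarith
    obtain ⟨M, hM⟩ := eventually_atTop.1
      ((hlim.eventually_lt_const hlt).and (eventually_gt_atTop 0))
    refine mem_iUnion.2 ⟨M, hω, fun N hN => ?_⟩
    obtain ⟨h1, h2⟩ := hM N hN
    rw [hP, infinitePi_bern_cylinder hp hq]
    refine ENNReal.ofReal_le_ofReal ?_
    rw [Real.rpow_def_of_pos (by positivity), Real.exp_le_exp, Real.log_pow, one_div, Real.log_inv]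
    rw [div_lt_iff₀ (by exact_mod_cast h2)] at h1
    linarith
  obtain ⟨M, hM⟩ : ∃ M, P (A M) ≠ 0 := by
    by_contra! h0
    have h1 := measure_iUnion_null h0
    rw [measure_eq_zero_iff_ae_notMem] at h1
    obtain ⟨ω, h2, h3⟩ := (h1.and hA).exists
    exact h2 h3
  have hmeas : Measurable (Real.ofDigits (b := 2)) := Real.continuous_ofDigits.measurable
  have hsub : Real.ofDigits '' A M ⊆ lyapLevelSet β := by
    rintro _ ⟨ω, hω, rfl⟩
    exact ofDigits_mem_lyapLevelSet hp (by linarith) hpβ hω.1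
  refine le_trans ?_ (dimH_mono hsub)
  refine le_dimH_of_measure_le_dyadic (ν := (P.restrict (A M)).map Real.ofDigits) (C := 5) ht
    (by norm_num) M (fun h0 => hM ?_) fun N hN U hU => ?_
  · refine nonpos_iff_eq_zero.1 (le_trans ?_ h0.le)
    refine le_trans ?_ (Measure.le_map_apply hmeas.aemeasurable _)
    exact (Measure.restrict_apply_self P (A M)).ge.trans (measure_mono (subset_preimage_image _ _))
  · refine (measure_mono subset_closure).trans ?_
    rw [Measure.map_apply hmeas isClosed_closure.measurableSet,
      Measure.restrict_apply (hmeas isClosed_closure.measurableSet),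
      ENNReal.ofReal_mul (by norm_num), ENNReal.ofReal_ofNat]
    refine measure_le_of_abs_ofDigits_sub_le (N := N) (fun ω hω ω' hω' => ?_)
      fun ω hω => hω.2.2 N hN
    rw [← Metric.ediam_closure] at hU
    have := (Metric.edist_le_ediam_of_mem (s := closure U) (mem_preimage.1 hω.1)
      (mem_preimage.1 hω'.1)).trans hU
    rwa [edist_dist, Real.dist_eq, ENNReal.ofReal_le_ofReal_iff (by positivity)] at this

end P2GLE

theorem lyapunov_spectrum (β : ℝ) (hβ : Real.log 2 < β) :
    dimH (lyapLevelSet β) =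
      ENNReal.ofReal
        ((1 / β) * Real.log (β / Real.log 2 - 1) -
          (1 / Real.log 2) * Real.log (1 - Real.log 2 / β)) := by

  have hL : 0 < Real.log 2 := Real.log_pos (by norm_num)
  have hβ0 : 0 < β := hL.trans hβ
  set p := Real.log 2 / β with hp_def
  have hp : 0 < p := div_pos hL hβ0
  have hp1 : p < 1 := (div_lt_one hβ0).2 hβ
  have hpβ : p * β = Real.log 2 := div_mul_cancel₀ _ hβ0.ne'
  have hq : 0 < 1 - p := by linarith
  have hlog : Real.log (β / Real.log 2 - 1) = Real.log (1 - p) - Real.log p := by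
    rw [← Real.log_div hq.ne' hp.ne', hp_def]
    congr 1
    field_simp
  have hval : (1 / β) * Real.log (β / Real.log 2 - 1) - (1 / Real.log 2) * Real.log (1 - p) =
      -(p * Real.log p + (1 - p) * Real.log (1 - p)) / Real.log 2 := by
    rw [hlog, show 1 / β = p / Real.log 2 by rw [hp_def]; field_simp]
    field_simp
    ring
  rw [hval]
  set s := -(p * Real.log p + (1 - p) * Real.log (1 - p)) / Real.log 2 with hs_def
  have hs : s * Real.log 2 = -(p * Real.log p + (1 - p) * Real.log (1 - p)) :=
    div_mul_cancel₀ _ hL.ne'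
  have hs0 : 0 < s := by
    refine div_pos ?_ hL
    have h1 := mul_neg_of_pos_of_neg hp (Real.log_neg hp hp1)
    have h2 := mul_neg_of_pos_of_neg hq (Real.log_neg hq (by linarith))
    linarith
  refine le_antisymm ?_ ?_
  · refine ge_of_tendsto (x := 𝓝[>] s)
      ((ENNReal.continuous_ofReal.tendsto s).mono_left nhdsWithin_le_nhds) ?_
    filter_upwards [self_mem_nhdsWithin] with t ht
    refine P2GLE.dimH_lyapLevelSet_le hβ hp hq (by ring) hpβ (hs0.trans ht) ?_
    rw [← hs]
    exact mul_lt_mul_of_pos_right ht hL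
  · refine le_of_tendsto (x := 𝓝[<] s)
      ((ENNReal.continuous_ofReal.tendsto s).mono_left nhdsWithin_le_nhds) ?_
    filter_upwards [Ioo_mem_nhdsLT hs0] with t ht
    refine P2GLE.le_dimH_lyapLevelSet hp hq (by ring) hpβ ht.1 ?_
    rw [← hs]
    exact mul_lt_mul_of_pos_right ht.2 hL
end

section
/- The ratio ( ∑_{n=1}^{∞} 2^{−n t} · log n ) / ( ∑_{n=1}^{∞} 2^{−n t} ) tends to +∞ as t → 0⁺. -/
open Filter Real Set

theorem summable_pow_mul_log {r : ℝ} (h0 : 0 ≤ r) (h1 : r < 1) :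
    Summable fun n : ℕ => r ^ n * Real.log n := by
  have h : Summable fun n : ℕ => (n : ℝ) ^ 1 * r ^ n :=
    summable_pow_mul_geometric_of_norm_lt_one 1 (by rwa [Real.norm_of_nonneg h0])
  refine h.of_nonneg_of_le
    (fun n => mul_nonneg (pow_nonneg h0 n) (Real.log_natCast_nonneg n)) fun n => ?_
  rw [pow_one, mul_comm]
  exact mul_le_mul_of_nonneg_right (Real.log_le_self n.cast_nonneg) (pow_nonneg h0 n)

/-- Discarding the first `N` terms bounds the logarithmic average against geometric weights. -/
theorem pow_mul_log_le_tsum_div_tsum {r : ℝ} (h0 : 0 < r) (h1 : r < 1) (N : ℕ) :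
    r ^ N * Real.log N ≤
      (∑' n : ℕ+, r ^ (n : ℕ) * Real.log (n : ℕ)) / ∑' n : ℕ+, r ^ (n : ℕ) := by
  have hg : Summable fun n : ℕ => r ^ (n + 1) :=
    (summable_nat_add_iff 1).2 (summable_geometric_of_lt_one h0.le h1)
  have hl : Summable fun n : ℕ => r ^ (n + 1) * Real.log (n + 1 : ℕ) :=
    (summable_nat_add_iff 1).2 (summable_pow_mul_log h0.le h1)
  have hnn (n : ℕ) : 0 ≤ r ^ (n + 1) * Real.log (n + 1 : ℕ) :=
    mul_nonneg (pow_nonneg h0.le _) (Real.log_natCast_nonneg _)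
  rw [tsum_pnat_eq_tsum_succ (f := fun n : ℕ => r ^ n * Real.log n),
    tsum_pnat_eq_tsum_succ (f := fun n : ℕ => r ^ n),
    le_div_iff₀ (hg.tsum_pos (fun n => (pow_pos h0 _).le) 0 (pow_pos h0 _)),
    ← hl.sum_add_tsum_nat_add N, ← tsum_mul_left]
  refine le_add_of_nonneg_of_le (Finset.sum_nonneg fun n _ => hnn n)
    ((hg.mul_left _).tsum_le_tsum (fun n => ?_) ((summable_nat_add_iff N).2 hl))
  have hlog : Real.log N ≤ Real.log (n + N + 1 : ℕ) := by
    rcases N.eq_zero_or_pos with rfl | hN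
    · simpa using Real.log_natCast_nonneg (n + 1)
    · exact Real.log_le_log (by exact_mod_cast hN) (by exact_mod_cast (by omega))
  calc r ^ N * Real.log N * r ^ (n + 1) = r ^ (n + N + 1) * Real.log N := by ring
    _ ≤ _ := mul_le_mul_of_nonneg_left hlog (pow_nonneg h0.le _)

theorem partial_pressure_tendsto_atTop :
    Tendsto
      (fun t : ℝ =>
        (∑' n : ℕ+, (2:ℝ) ^ (-((n : ℕ) : ℝ) * t) * Real.log ((n : ℕ) : ℝ)) /
          (∑' n : ℕ+, (2:ℝ) ^ (-((n : ℕ) : ℝ) * t)))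
      (nhdsWithin 0 (Ioi 0)) atTop := by
  have hpow (n : ℕ) (t : ℝ) : (2 : ℝ) ^ (-(n : ℝ) * t) = ((2 : ℝ) ^ (-t)) ^ n := by
    rw [← Real.rpow_mul_natCast zero_le_two]
    ring_nf
  simp only [hpow]
  refine tendsto_atTop.2 fun M => ?_
  obtain ⟨N, hN⟩ :=
    ((Real.tendsto_log_atTop.comp tendsto_natCast_atTop_atTop).eventually_gt_atTop M).exists
  have hc : Continuous fun t : ℝ => ((2 : ℝ) ^ (-t)) ^ N * Real.log N :=
    (((Real.continuous_const_rpow two_ne_zero).comp continuous_neg).pow N).mul continuous_const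
  have hev := (hc.tendsto 0).eventually (lt_mem_nhds (a := M) (by simpa using hN))
  filter_upwards [nhdsWithin_le_nhds hev, self_mem_nhdsWithin] with t hM ht
  exact hM.le.trans (pow_mul_log_le_tsum_div_tsum (by positivity)
    (Real.rpow_lt_one_of_one_lt_of_neg one_lt_two (neg_neg_of_pos ht)) N)
end
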